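/- arXiv:1603.08623 — 3 statements merged into one kernel-verified Lean document; each statement's English description precedes it below -/
import Mathlib

section
/- Fix n ≥ 3. Let S be a set of integral binary forms of degree n defined by congruence conditions modulo bounded powers of primes: there is a bound J and, for each prime p, an integer j_p ≤ J and a subset Σ_p of coefficient vectors in (ℤ/p^{j_p}ℤ)^{n+1} such that S consists exactly of the integral binary n-ic forms whose coefficient vector modulo p^{j_p} lies in Σ_p for every prime p. Assume there exist two polynomials g₁, g₂ ∈ ℤ[c₀, …, c_n] with no common nonconstant factor (so that their common zero locus has codimension ≥ 2 in affine (n+1)-space) such that for all sufficiently large primes p, every coefficient vector modulo p excluded from Σ_p satisfies g₁ ≡ g₂ ≡ 0 (mod p). Let N(S;X) be the number of forms in S that are irreducible over ℚ, have Galois group S_n (for the splitting field of F(x,1)), have positive leading coefficient, and have all coefficients less than X in absolute value. Then N(S;X) ∼ 2ⁿ·X^{n+1}·∏_p μ_p(S) as X → ∞, where μ_p(S) = |Σ_p|/p^{j_p(n+1)} is the p-adic density of S. -/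
open Finset

/-- Evaluation of the binary form of degree `n` with coefficient vector `c` at `(x, y)`:
`c 0 * x^n + c 1 * x^(n-1) * y + ⋯ + c n * y^n`. -/
def binEval {n : ℕ} {R : Type*} [CommRing R] (c : Fin (n + 1) → R) (x y : R) : R :=
  ∑ i : Fin (n + 1), c i * x ^ (n - (i : ℕ)) * y ^ (i : ℕ)

/-- The binary form with coefficient vector `c` as an element of `MvPolynomial (Fin 2) R`. -/
noncomputable def formPolyR {n : ℕ} {R : Type*} [CommRing R] (c : Fin (n + 1) → R) :
    MvPolynomial (Fin 2) R :=
  ∑ i : Fin (n + 1), MvPolynomial.C (c i) * MvPolynomial.X 0 ^ (n - (i : ℕ)) *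
    MvPolynomial.X 1 ^ (i : ℕ)

/-- The binary form with integer coefficient vector `c`, base-changed to `R`. -/
noncomputable def formPoly {n : ℕ} (R : Type*) [CommRing R] (c : Fin (n + 1) → ℤ) :
    MvPolynomial (Fin 2) R :=
  formPolyR (fun i => ((c i : R)))

/-- `F(X, 1)` over `R`, for the binary form with integer coefficient vector `c`. -/
noncomputable def formPolyX {n : ℕ} (R : Type*) [CommRing R] (c : Fin (n + 1) → ℤ) :
    Polynomial R :=
  ∑ i : Fin (n + 1), Polynomial.C ((c i : R)) * Polynomial.X ^ (n - (i : ℕ))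

/-- `IsDisc c D`: the binary form with coefficient vector `c` factors over `ℂ` as
`∏ (αᵢ x - βᵢ y)` and `D = ∏_{i<j} (αᵢ βⱼ - αⱼ βᵢ)²` is its discriminant. -/
def IsDisc {n : ℕ} (c : Fin (n + 1) → ℤ) (D : ℤ) : Prop :=
  ∃ α β : Fin n → ℂ,
    (∀ x y : ℂ, binEval (fun i => ((c i : ℂ))) x y = ∏ i : Fin n, (α i * x - β i * y)) ∧
    (D : ℂ) = ∏ i : Fin n, ∏ j ∈ Finset.univ.filter (fun j => i < j),
      (α i * β j - α j * β i) ^ 2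

/-- `G` is a maximal form: it is not a proper subform of any integral binary form. -/
def IsMaximalForm {n : ℕ} (G : Fin (n + 1) → ℤ) : Prop :=
  ¬ ∃ (F : Fin (n + 1) → ℤ) (a b c d : ℤ), 1 < |a * d - b * c| ∧
      ∀ x y : ℤ, binEval G x y = binEval F (a * x + b * y) (c * x + d * y)

/-- `GL₂(ℤ)`-equivalence of integral binary forms. -/
def FormEquiv {n : ℕ} (F G : Fin (n + 1) → ℤ) : Prop :=
  ∃ a b c d : ℤ, |a * d - b * c| = 1 ∧
    ∀ x y : ℤ, binEval G x y = binEval F (a * x + b * y) (c * x + d * y)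

/-- The form locally represents `h` everywhere: over `ℝ` and over `ℤ_p` for all primes `p`. -/
def LocallyRep {n : ℕ} (c : Fin (n + 1) → ℤ) (h : ℤ) : Prop :=
  (∃ x y : ℝ, binEval (fun i => ((c i : ℝ))) x y = (h : ℝ)) ∧
  ∀ (p : ℕ) (hp : p.Prime),
    haveI : Fact p.Prime := ⟨hp⟩
    ∃ x y : ℤ_[p], binEval (fun i => ((c i : ℤ_[p]))) x y = (h : ℤ_[p])

/-- The integral binary form is primitive: the gcd of its coefficients is 1. -/
def IsPrimitiveForm {n : ℕ} (c : Fin (n + 1) → ℤ) : Prop :=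
  ∀ d : ℤ, (∀ i, d ∣ c i) → IsUnit d

/-- The form splits completely modulo `p`: modulo `p` it is a product of pairwise
non-proportional linear forms over `ℤ/pℤ`. -/
def SplitsCompletelyMod (p : ℕ) {n : ℕ} (c : Fin (n + 1) → ℤ) : Prop :=
  ∃ L : Fin n → ZMod p × ZMod p,
    (∀ i j, i ≠ j → (L i).1 * (L j).2 ≠ (L j).1 * (L i).2) ∧
    formPoly (ZMod p) c =
      ∏ i : Fin n, (MvPolynomial.C (L i).1 * MvPolynomial.X 0 +
        MvPolynomial.C (L i).2 * MvPolynomial.X 1)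

/-- The positive half of the box of height less than `X`. -/
def halfBox (n : ℕ) (X : ℝ) : Set (Fin (n + 1) → ℤ) :=
  {c | 0 < c 0 ∧ ∀ i, |(c i : ℝ)| < X}

theorem abs_card_filter_modEq_sub_le {a b : ℤ} (hab : a ≤ b) {N : ℕ} (hN : 0 < N) (v : ℤ) :
    |(#{x ∈ Ico a b | x ≡ v [ZMOD N]} : ℝ) - (b - a) / N| ≤ 1 := by
  have h := Int.Ico_filter_modEq_card a b (r := (N : ℤ)) (by exact_mod_cast hN) v
  have hNq : (0 : ℚ) < N := by exact_mod_cast hN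
  have hle : ((a : ℚ) - v) / N ≤ (b - v) / N := by
    have : (a : ℚ) ≤ b := by exact_mod_cast hab
    gcongr
  have h0 : 0 ≤ ⌈((b : ℚ) - v) / (N : ℤ)⌉ - ⌈((a : ℚ) - v) / (N : ℤ)⌉ := by
    have := Int.ceil_mono hle
    push_cast
    omega
  rw [max_eq_left h0] at h
  have hq : |(#{x ∈ Ico a b | x ≡ v [ZMOD N]} : ℚ) - (b - a) / N| ≤ 1 := by
    have h' : (#{x ∈ Ico a b | x ≡ v [ZMOD N]} : ℚ) =
        (⌈((b : ℚ) - v) / (N : ℤ)⌉ : ℚ) - ⌈((a : ℚ) - v) / (N : ℤ)⌉ := by exact_mod_cast h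
    push_cast at h'
    rw [h']
    have h1 := Int.le_ceil (((b : ℚ) - v) / N)
    have h2 := Int.ceil_lt_add_one (((b : ℚ) - v) / N)
    have h3 := Int.le_ceil (((a : ℚ) - v) / N)
    have h4 := Int.ceil_lt_add_one (((a : ℚ) - v) / N)
    have e : ((b : ℚ) - a) / N = (b - v) / N - (a - v) / N := by ring
    rw [e, abs_le]
    constructor <;> linarith
  exact_mod_cast hq

theorem tendsto_card_filter_modEq_div {a b : ℝ → ℤ} {L : ℝ}
    (hab : ∀ᶠ X in Filter.atTop, a X ≤ b X)
    (hL : Filter.Tendsto (fun X : ℝ => ((b X : ℝ) - a X) / X) Filter.atTop (nhds L))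
    {N : ℕ} (hN : 0 < N) (v : ℤ) :
    Filter.Tendsto (fun X : ℝ => (#{x ∈ Ico (a X) (b X) | x ≡ v [ZMOD N]} : ℝ) / X)
      Filter.atTop (nhds (L / N)) := by
  have h1 : Filter.Tendsto (fun X : ℝ => ((b X : ℝ) - a X) / X / N) Filter.atTop (nhds (L / N)) :=
    hL.div_const _
  have h2 : Filter.Tendsto (fun X : ℝ => (#{x ∈ Ico (a X) (b X) | x ≡ v [ZMOD N]} : ℝ) / X -
      ((b X : ℝ) - a X) / X / N) Filter.atTop (nhds 0) := by
    refine squeeze_zero_norm' ?_ tendsto_inv_atTop_zero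
    filter_upwards [hab, Filter.eventually_gt_atTop 0] with X hX hX0
    have := abs_card_filter_modEq_sub_le hX hN v
    have e : (#{x ∈ Ico (a X) (b X) | x ≡ v [ZMOD N]} : ℝ) / X - ((b X : ℝ) - a X) / X / N =
      ((#{x ∈ Ico (a X) (b X) | x ≡ v [ZMOD N]} : ℝ) - (b X - a X) / N) / X := by
      field_simp
    rw [e, Real.norm_eq_abs, abs_div, abs_of_pos hX0, ← one_div]
    gcongr
  simpa using h2.add h1

theorem tendsto_ceil_div :
    Filter.Tendsto (fun X : ℝ => (⌈X⌉ : ℝ) / X) Filter.atTop (nhds 1) := by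
  refine (tendsto_nat_ceil_div_atTop (R := ℝ)).congr' ?_
  filter_upwards [Filter.eventually_ge_atTop 0] with X hX
  rw [natCast_ceil_eq_intCast_ceil hX]

/-- Coordinate ranges of the half box. -/
noncomputable def halfBoxLower {n : ℕ} (X : ℝ) (i : Fin (n + 1)) : ℤ :=
  if i = 0 then 1 else -⌈X⌉ + 1

theorem mem_halfBox_iff {n : ℕ} {X : ℝ} {c : Fin (n + 1) → ℤ} :
    c ∈ halfBox n X ↔ ∀ i, c i ∈ Ico (halfBoxLower X i) ⌈X⌉ := by
  simp only [halfBox, Set.mem_ofPred_eq, mem_Ico, halfBoxLower]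
  constructor
  · rintro ⟨h0, h⟩ i
    have hi := abs_lt.1 (h i)
    have h2 : c i < ⌈X⌉ := Int.lt_ceil.2 hi.2
    have h3 : -c i < ⌈X⌉ := Int.lt_ceil.2 (by push_cast; linarith)
    split_ifs with h4
    · subst h4; omega
    · omega
  · intro h
    refine ⟨by have := h 0; simp at this; omega, fun i => ?_⟩
    have h0 := h 0
    have hi := h i
    simp only [if_true] at h0
    have h3 : -c i < ⌈X⌉ := by
      split_ifs at hi <;> omega
    have h2 := Int.lt_ceil.1 hi.2
    have h3 := Int.lt_ceil.1 h3
    push_cast at h3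
    rw [abs_lt]
    constructor <;> linarith

theorem halfBox_finite (n : ℕ) (X : ℝ) : (halfBox n X).Finite := by
  refine (Fintype.piFinset fun i => Ico (halfBoxLower X i) ⌈X⌉).finite_toSet.subset ?_
  intro c hc
  simpa [Fintype.mem_piFinset] using mem_halfBox_iff.1 hc

theorem tendsto_card_halfBox_residue (n : ℕ) {N : ℕ} (hN : 0 < N) (v : Fin (n + 1) → ZMod N) :
    Filter.Tendsto (fun X : ℝ =>
      (Set.ncard {c | c ∈ halfBox n X ∧ (fun i => (c i : ZMod N)) = v} : ℝ) / X ^ (n + 1))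
      Filter.atTop (nhds (2 ^ n / (N : ℝ) ^ (n + 1))) := by
  have : NeZero N := ⟨hN.ne'⟩
  have key : ∀ X : ℝ,
      (Set.ncard {c | c ∈ halfBox n X ∧ (fun i => (c i : ZMod N)) = v} : ℝ) / X ^ (n + 1) =
      ∏ i : Fin (n + 1),
        ((#{x ∈ Ico (halfBoxLower X i) ⌈X⌉ | x ≡ ((v i).val : ℤ) [ZMOD N]} : ℝ) / X) := by
    intro X
    have : {c | c ∈ halfBox n X ∧ (fun i => (c i : ZMod N)) = v} =
        (Fintype.piFinset fun i =>
          {x ∈ Ico (halfBoxLower X i) ⌈X⌉ | x ≡ ((v i).val : ℤ) [ZMOD N]} : Set _) := by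
      ext c
      simp only [Set.mem_ofPred_eq, mem_halfBox_iff, Fintype.coe_piFinset, Set.mem_pi,
        Set.mem_univ, coe_filter, forall_true_left, funext_iff, ← forall_and,
        ← ZMod.intCast_eq_intCast_iff]
      simp
    rw [this, Set.ncard_coe_finset, Fintype.card_piFinset, Finset.prod_div_distrib]
    simp
  simp_rw [key]
  have hlim : (2 : ℝ) ^ n / (N : ℝ) ^ (n + 1) =
      ∏ i : Fin (n + 1), ((if i = 0 then 1 else 2 : ℝ) / N) := by
    rw [Fin.prod_univ_succ]
    simp [Fin.succ_ne_zero, pow_succ]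
    field_simp
  rw [hlim]
  refine tendsto_finsetProd _ fun i _ => tendsto_card_filter_modEq_div ?_ ?_ hN _
  · filter_upwards [Filter.eventually_ge_atTop 1] with X hX
    have : 1 ≤ ⌈X⌉ := Int.one_le_ceil_iff.2 (by linarith)
    unfold halfBoxLower
    split_ifs <;> omega
  · have h1 : Filter.Tendsto (fun X : ℝ => (1 : ℝ) / X) Filter.atTop (nhds 0) := by
      simpa using tendsto_inv_atTop_zero (𝕜 := ℝ)
    unfold halfBoxLower
    split_ifs with h
    · have := tendsto_ceil_div.sub h1
      simp only [sub_zero] at this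
      refine this.congr fun X => ?_
      push_cast; ring
    · have := (tendsto_ceil_div.const_mul 2).sub h1
      simp only [sub_zero, mul_one] at this
      refine this.congr fun X => ?_
      push_cast; ring

theorem tendsto_card_halfBox_mem (n : ℕ) {N : ℕ} (hN : 0 < N) (T : Set (Fin (n + 1) → ZMod N)) :
    Filter.Tendsto (fun X : ℝ =>
      (Set.ncard {c | c ∈ halfBox n X ∧ (fun i => (c i : ZMod N)) ∈ T} : ℝ) / X ^ (n + 1))
      Filter.atTop (nhds (2 ^ n * ((Nat.card T : ℝ) / (N : ℝ) ^ (n + 1)))) := by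
  classical
  have : NeZero N := ⟨hN.ne'⟩
  have key : ∀ X : ℝ,
      (Set.ncard {c | c ∈ halfBox n X ∧ (fun i => (c i : ZMod N)) ∈ T} : ℝ) / X ^ (n + 1) =
      ∑ v ∈ T.toFinset,
        (Set.ncard {c | c ∈ halfBox n X ∧ (fun i => (c i : ZMod N)) = v} : ℝ) / X ^ (n + 1) := by
    intro X
    rw [← Finset.sum_div]
    congr 1
    have hf := halfBox_finite n X
    have e : ∀ P : (Fin (n + 1) → ℤ) → Prop, Set.ncard {c | c ∈ halfBox n X ∧ P c} =
        #{c ∈ hf.toFinset | P c} := by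
      intro P
      rw [← Set.ncard_coe_finset]
      congr 1
      ext c
      simp
    rw [e]
    simp_rw [e]
    rw [← Nat.cast_sum, Finset.card_eq_sum_card_fiberwise (t := T.toFinset)
      (f := fun c i => (c i : ZMod N))]
    · congr 1
      refine Finset.sum_congr rfl fun v hv => ?_
      congr 1
      ext c
      simp only [mem_filter]
      constructor
      · rintro ⟨⟨h1, h2⟩, h3⟩; exact ⟨h1, h3⟩
      · rintro ⟨h1, h3⟩; exact ⟨⟨h1, by simpa [h3] using hv⟩, h3⟩
    · intro c hc
      simpa using (by simpa using hc : _ ∧ _).2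
  simp_rw [key]
  have : (2 : ℝ) ^ n * ((Nat.card T : ℝ) / (N : ℝ) ^ (n + 1)) =
      ∑ v ∈ T.toFinset, 2 ^ n / (N : ℝ) ^ (n + 1) := by
    rw [Finset.sum_const, nsmul_eq_mul, Set.toFinset_card, Nat.card_eq_fintype_card]
    ring
  rw [this]
  exact tendsto_finsetSum _ fun v _ => tendsto_card_halfBox_residue n hN v

theorem tendsto_card_halfBox_forall_mem (n : ℕ) (Q : Finset ℕ) (a : ℕ → ℕ)
    (ha : ∀ q ∈ Q, 0 < a q) (hco : ∀ p ∈ Q, ∀ q ∈ Q, p ≠ q → (a p).Coprime (a q))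
    (T : ∀ q, Set (Fin (n + 1) → ZMod (a q))) :
    Filter.Tendsto (fun X : ℝ =>
      (Set.ncard {c | c ∈ halfBox n X ∧ ∀ q ∈ Q, (fun i => (c i : ZMod (a q))) ∈ T q} : ℝ)
        / X ^ (n + 1))
      Filter.atTop (nhds (2 ^ n * ∏ q ∈ Q, ((Nat.card (T q) : ℝ) / (a q : ℝ) ^ (n + 1)))) := by
  have hco' : Pairwise (Function.onFun Nat.Coprime fun q : Q => a q) := fun p q h =>
    hco p p.2 q q.2 fun h' => h (Subtype.ext h')
  let e := ZMod.prodEquivPi (fun q : Q => a q) hco'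
  have hN : 0 < ∏ q : Q, a q := Finset.prod_pos fun q _ => ha q q.2
  let E : (Fin (n + 1) → ZMod (∏ q : Q, a q)) ≃ (∀ q : Q, Fin (n + 1) → ZMod (a q)) :=
    (Equiv.arrowCongr (Equiv.refl _) e.toEquiv).trans (Equiv.piComm _)
  let T' : Set (Fin (n + 1) → ZMod (∏ q : Q, a q)) := {v | ∀ q : Q, E v q ∈ T q}
  have hT' : Nat.card T' = ∏ q : Q, Nat.card (T q) := by
    rw [← Nat.card_pi]
    refine Nat.card_congr ((E.subtypeEquiv (q := fun w => ∀ q : Q, w q ∈ T q)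
      fun v => Iff.rfl).trans ?_)
    exact Equiv.subtypePiEquivPi
  have h := tendsto_card_halfBox_mem n hN T'
  rw [hT'] at h
  have h2 : ((∏ q : Q, Nat.card (T q) : ℕ) : ℝ) / ((∏ q : Q, a q : ℕ) : ℝ) ^ (n + 1) =
      ∏ q ∈ Q, ((Nat.card (T q) : ℝ) / (a q : ℝ) ^ (n + 1)) := by
    push_cast
    rw [← Finset.prod_pow, ← Finset.prod_div_distrib]
    exact Finset.prod_coe_sort Q fun q => (Nat.card (T q) : ℝ) / (a q : ℝ) ^ (n + 1)
  rw [h2] at h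
  refine h.congr fun X => ?_
  congr 3
  ext c
  have hE : ∀ q : Q, E (fun i => (c i : ZMod (∏ q : Q, a q))) q = fun i => (c i : ZMod (a q)) := by
    intro q
    ext i
    change e (c i : ZMod (∏ q : Q, a q)) q = _
    rw [map_intCast]
    rfl
  simp only [T', Set.mem_ofPred_eq, hE, Subtype.forall]

theorem Subgroup.eq_top_of_isCycle_card {α : Type*} [Fintype α] [DecidableEq α]
    (G : Subgroup (Equiv.Perm α)) (hα : 3 ≤ Fintype.card α) {σ τ ρ : Equiv.Perm α}
    (hσ : σ ∈ G) (hτ : τ ∈ G) (hρ : ρ ∈ G)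
    (hσc : σ.IsCycle) (hσn : #σ.support = Fintype.card α)
    (hτc : τ.IsCycle) (hτn : #τ.support = Fintype.card α - 1)
    (hρn : #ρ.support = 2) : G = ⊤ := by
  have htrans : ∀ x y : α, ∃ g ∈ G, g x = y := by
    intro x y
    have hs : σ.support = univ := (Finset.card_eq_iff_eq_univ _).1 hσn
    have hm : ∀ z, σ z ≠ z := fun z => Equiv.Perm.mem_support.1 (hs ▸ mem_univ z)
    obtain ⟨i, hi⟩ := hσc.sameCycle (hm x) (hm y)
    exact ⟨σ ^ i, G.zpow_mem hσ i, hi⟩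
  obtain ⟨r, hr⟩ : ∃ r, τ.supportᶜ = {r} := by
    rw [← Finset.card_eq_one, Finset.card_compl, hτn]
    omega
  have hfix : τ r = r := by
    have : r ∈ τ.supportᶜ := by simp [hr]
    simpa using this
  have hmov : ∀ x, x ≠ r → τ x ≠ x := by
    intro x hx
    have : x ∉ τ.supportᶜ := by simpa [hr] using hx
    simpa using this
  have h2 : ∀ a b x y : α, a ≠ b → x ≠ y → ∃ g ∈ G, g a = x ∧ g b = y := by
    intro a b x y hab hxy
    obtain ⟨h, hh, ha⟩ := htrans a r
    obtain ⟨k, hk, hx⟩ := htrans x r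
    have hb : h b ≠ r := fun e => hab (h.injective (by rw [ha, e]))
    have hy : k y ≠ r := fun e => hxy (k.injective (by rw [hx, e]))
    obtain ⟨i, hi⟩ := hτc.sameCycle (hmov _ hb) (hmov _ hy)
    refine ⟨k⁻¹ * τ ^ i * h, G.mul_mem (G.mul_mem (G.inv_mem hk) (G.zpow_mem hτ i)) hh, ?_, ?_⟩
    · simp only [Equiv.Perm.coe_mul, Function.comp_apply, ha]
      rw [Equiv.Perm.zpow_apply_eq_self_of_apply_eq_self hfix, Equiv.Perm.inv_eq_iff_eq, hx]
    · simp only [Equiv.Perm.coe_mul, Function.comp_apply, hi]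
      simp
  obtain ⟨a, b, hab, rfl⟩ := Equiv.Perm.card_support_eq_two.1 hρn
  rw [eq_top_iff, ← Equiv.Perm.closure_isSwap, Subgroup.closure_le]
  rintro _ ⟨x, y, hxy, rfl⟩
  obtain ⟨g, hg, rfl, rfl⟩ := h2 a b x y hab hxy
  rw [Equiv.swap_apply_apply]
  exact G.mul_mem (G.mul_mem hg hρ) (G.inv_mem hg)

open Polynomial in
theorem separable_of_factorization {F : Type*} [Field F] [Finite F] {f g : F[X]} {u : F}
    {S : Finset F} (hu : u ≠ 0) (hg : Irreducible g) (hd : 2 ≤ g.natDegree)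
    (hf : f = C u * g * ∏ s ∈ S, (X - C s)) : f.Separable := by
  have hgs : g.Separable := PerfectField.separable_of_irreducible hg
  have hS : (∏ s ∈ S, (X - C s)).Separable :=
    separable_prod_X_sub_C_iff'.2 fun x _ y _ h => h
  have hco : IsCoprime g (∏ s ∈ S, (X - C s)) := by
    refine IsCoprime.prod_right fun s _ => ?_
    rw [hg.coprime_iff_not_dvd]
    intro h
    have := natDegree_le_of_dvd h (X_sub_C_ne_zero s)
    rw [natDegree_X_sub_C] at this
    omega
  rw [hf, mul_assoc]
  exact ((hgs.mul hS hco).unit_mul (isUnit_C.2 hu.isUnit))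

open Polynomial in
/-- A permutation of the roots of `f` lifting the Frobenius of `𝔽_p` is a cycle of length `deg g`
when `f` is, over `𝔽_p`, a product of an irreducible `g` and distinct linear factors. -/
theorem isCycle_of_lifts_frobenius {p : ℕ} [Fact p.Prime] {k : Type*} [Field k] [Finite k]
    [Algebra (ZMod p) k] {R : Type*} [Fintype R] [DecidableEq R] {f g : (ZMod p)[X]} {u : ZMod p}
    {S : Finset (ZMod p)} (hu : u ≠ 0) (hg : Irreducible g) (hd : 2 ≤ g.natDegree)
    (hf : f = C u * g * ∏ s ∈ S, (X - C s)) {a : k} (r : R → k)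
    (hr : f.map (algebraMap (ZMod p) k) = C a * ∏ x : R, (X - C (r x)))
    (σ : Equiv.Perm R) (hσ : ∀ x, r (σ x) = r x ^ p) :
    σ.IsCycle ∧ #σ.support = g.natDegree := by
  classical
  have hsep := (separable_of_factorization hu hg hd hf).map (f := algebraMap (ZMod p) k)
  have hf0 : f.map (algebraMap (ZMod p) k) ≠ 0 := hsep.ne_zero
  have ha : a ≠ 0 := by
    rintro rfl
    rw [hr] at hf0
    simp at hf0
  have hinj : Function.Injective r := by
    rw [hr] at hsep
    exact separable_prod_X_sub_C_iff.1 hsep.of_mul_right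
  have hroot : ∀ z : k, aeval z f = 0 ↔ ∃ x, r x = z := by
    intro z
    rw [aeval_def, ← eval_map, hr, eval_mul, eval_C, eval_prod]
    simp only [eval_sub, eval_X, eval_C, mul_eq_zero, ha, false_or, Finset.prod_eq_zero_iff,
      mem_univ, true_and, sub_eq_zero]
    exact ⟨fun ⟨x, hx⟩ => ⟨x, hx.symm⟩, fun ⟨x, hx⟩ => ⟨x, hx.symm⟩⟩
  have hfg : g ∣ f := by rw [hf]; exact ⟨C u * ∏ s ∈ S, (X - C s), by ring⟩
  have hgdvd : g.map (algebraMap (ZMod p) k) ∣ f.map (algebraMap (ZMod p) k) :=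
    Polynomial.map_dvd _ hfg
  have hsplit : (g.map (algebraMap (ZMod p) k)).Splits := by
    refine Splits.of_dvd ?_ hf0 hgdvd
    rw [hr]
    exact (Splits.prod fun _ _ => Splits.X_sub_C _).C_mul _
  have hgsep : (g.map (algebraMap (ZMod p) k)).Separable := hsep.of_dvd hgdvd
  have hg0 : g.map (algebraMap (ZMod p) k) ≠ 0 := hgsep.ne_zero
  let D : Finset R := {x | aeval (r x) g = 0}
  have hDcard : #D = g.natDegree := by
    rw [← Finset.card_image_of_injective D hinj, ← natDegree_map (algebraMap (ZMod p) k),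
      hsplit.natDegree_eq_card_roots,
      ← Multiset.toFinset_card_of_nodup (nodup_roots hgsep)]
    congr 1
    ext z
    simp only [mem_image, D, mem_filter, mem_univ, true_and, Multiset.mem_toFinset,
      mem_roots hg0, IsRoot, eval_map, ← aeval_def]
    constructor
    · rintro ⟨x, hx, rfl⟩; exact hx
    · intro hz
      obtain ⟨x, rfl⟩ := (hroot z).1 (by
        obtain ⟨q, hq⟩ := hfg
        rw [hq, map_mul, hz, zero_mul])
      exact ⟨x, hz, rfl⟩
  have hpow : ∀ (i : ℕ) (x : R), r ((σ ^ i) x) = r x ^ p ^ i := by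
    intro i
    induction i with
    | zero => simp
    | succ i ih =>
      intro x
      rw [pow_succ', Equiv.Perm.mul_apply, hσ, ih, ← pow_mul, pow_succ]
  have htrans : ∀ x ∈ D, ∀ y ∈ D, σ.SameCycle x y := by
    intro x hx y hy
    simp only [D, mem_filter, mem_univ, true_and] at hx hy
    have hxa : IsAlgebraic (ZMod p) (r x) := Algebra.IsAlgebraic.isAlgebraic _
    have hmin : g ∣ minpoly (ZMod p) (r x) := by
      have h1 := minpoly.dvd _ _ hx
      exact ((minpoly.irreducible hxa.isIntegral).associated_of_dvd hg h1).symm.dvd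
    have hy' : aeval (r y) (minpoly (ZMod p) (r x)) = 0 := by
      obtain ⟨q, hq⟩ := hmin
      rw [hq, map_mul, hy, zero_mul]
    obtain ⟨φ, hφ⟩ := minpoly.exists_algEquiv_of_root' hxa hy'
    obtain ⟨i, hi⟩ := (FiniteField.bijective_frobeniusAlgEquivOfAlgebraic_pow (ZMod p) k).2 φ
    refine ⟨(i : ℕ), ?_⟩
    apply hinj
    rw [zpow_natCast, hpow, ← hφ, ← hi]
    simp only [AlgEquiv.coe_pow]
    rw [FiniteField.coe_frobeniusAlgEquivOfAlgebraic_iterate, ZMod.card]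
  have hmoved : ∀ x ∈ D, σ x ≠ x := by
    intro x hx hfix
    have : D ⊆ {x} := by
      intro y hy
      obtain ⟨i, hi⟩ := htrans x hx y hy
      rw [Equiv.Perm.zpow_apply_eq_self_of_apply_eq_self hfix] at hi
      simp [hi]
    have := Finset.card_le_card this
    rw [hDcard, card_singleton] at this
    omega
  have hfixed : ∀ x ∉ D, σ x = x := by
    intro x hx
    apply hinj
    rw [hσ]
    have h := (hroot (r x)).2 ⟨x, rfl⟩
    rw [hf] at h
    simp only [D, mem_filter, mem_univ, true_and] at hx
    simp only [map_mul, map_prod, mul_eq_zero, hx, or_false, aeval_C, map_eq_zero, hu, false_or,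
      Finset.prod_eq_zero_iff, map_sub, aeval_X, sub_eq_zero] at h
    obtain ⟨s, -, hs⟩ := h
    rw [hs, ← map_pow, ZMod.pow_card]
  have hsupp : σ.support = D := by
    ext x
    rw [Equiv.Perm.mem_support]
    exact ⟨fun h => by_contra fun h' => h (hfixed x h'), hmoved x⟩
  refine ⟨?_, by rw [hsupp, hDcard]⟩
  obtain ⟨x, hx⟩ : D.Nonempty := by rw [← Finset.card_pos, hDcard]; omega
  exact ⟨x, hmoved x hx, fun y hy => htrans x hx y (by rwa [← hsupp, Equiv.Perm.mem_support])⟩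

universe u in
open NumberField in
/-- Existence of a residue field of `K` of characteristic `p` with a lift of its Frobenius. -/
theorem exists_residueField_frobenius (K : Type u) [Field K] [NumberField K] [IsGalois ℚ K]
    (p : ℕ) [Fact p.Prime] :
    ∃ (k : Type u) (_ : Field k) (_ : Finite k) (_ : CharP k p) (φ : 𝓞 K →+* k) (σ : Gal(K/ℚ)),
      ∀ x, φ (σ • x) = φ x ^ p := by
  have hp : p.Prime := Fact.out
  have hmax : (Ideal.span {(p : ℤ)}).IsMaximal :=
    PrincipalIdealRing.isMaximal_of_irreducible (Nat.prime_iff_prime_int.1 hp).irreducible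
  obtain ⟨P, hPmax, hunder⟩ := Ideal.exists_ideal_over_maximal_of_isIntegral (S := 𝓞 K)
    (Ideal.span {(p : ℤ)}) (by
      rw [(RingHom.injective_iff_ker_eq_bot _).1 (FaithfulSMul.algebraMap_injective ℤ (𝓞 K))]
      exact bot_le)
  have hmem : ∀ m : ℤ, (m : 𝓞 K) ∈ P ↔ (p : ℤ) ∣ m := by
    intro m
    rw [← Ideal.mem_span_singleton, ← hunder, Ideal.mem_comap]
    simp
  have hP0 : P ≠ ⊥ := by
    rintro rfl
    have := (hmem p).2 dvd_rfl
    simp [hp.ne_zero] at this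
  have hfin : Finite (𝓞 K ⧸ P) := Ideal.finiteQuotientOfFreeOfNeBot P hP0
  have hchar : CharP (𝓞 K ⧸ P) p := by
    refine ⟨fun m => ?_⟩
    rw [← Int.natCast_dvd_natCast, ← hmem, ← Ideal.Quotient.eq_zero_iff_mem]
    simp
  obtain ⟨σ, hσ⟩ := IsArithFrobAt.exists_of_isInvariant (S := 𝓞 K) ℤ Gal(K/ℚ) P
  have hcard : Nat.card (ℤ ⧸ P.under ℤ) = p := by
    rw [show P.under ℤ = _ from hunder, Nat.card_congr (Int.quotientSpanNatEquivZMod p).toEquiv, Nat.card_zmod]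
  refine ⟨𝓞 K ⧸ P, Ideal.Quotient.field P, hfin, hchar, Ideal.Quotient.mk P, σ, fun x => ?_⟩
  have h := hσ.mk_apply x
  rw [hcard] at h
  exact h

open Polynomial NumberField in
/-- If `f ∈ ℤ[X]` factors modulo a prime `p` not dividing its leading coefficient as an
irreducible of degree `d ≥ 2` times distinct linear factors, then the Galois group of `f` over `ℚ`
contains an element acting on the roots as a `d`-cycle. -/
theorem exists_gal_isCycle {K : Type*} [Field K] [NumberField K] [IsGalois ℚ K]
    [DecidableEq K] {f : ℤ[X]}
    [Fact (((f.map (Int.castRingHom ℚ)).map (algebraMap ℚ K)).Splits)]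
    (hsepQ : (f.map (Int.castRingHom ℚ)).Separable) {p : ℕ} [Fact p.Prime]
    (hlc : ¬ (p : ℤ) ∣ f.leadingCoeff)
    {g : (ZMod p)[X]} {u : ZMod p} {S : Finset (ZMod p)}
    (hu : u ≠ 0) (hg : Irreducible g) (hd : 2 ≤ g.natDegree)
    (hf : f.map (Int.castRingHom (ZMod p)) = C u * g * ∏ s ∈ S, (X - C s)) :
    ∃ τ ∈ (Gal.galActionHom (f.map (Int.castRingHom ℚ)) K).range,
      τ.IsCycle ∧ #τ.support = g.natDegree := by
  classical
  set fQ := f.map (Int.castRingHom ℚ) with hfQ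
  have hsplit : (fQ.map (algebraMap ℚ K)).Splits := Fact.out
  have hsepK : (fQ.map (algebraMap ℚ K)).Separable := hsepQ.map
  set a : ℤ := f.leadingCoeff with ha
  have ha0 : a ≠ 0 := fun h => hlc (h ▸ dvd_zero _)
  have hfK : f.map (algebraMap ℤ K) = fQ.map (algebraMap ℚ K) := by
    rw [hfQ, Polynomial.map_map]
    congr 1
    exact RingHom.ext_int _ _
  have hfac : f.map (algebraMap ℤ K) = C (a : K) * ∏ x : fQ.rootSet K, (X - C (x : K)) := by
    rw [hfK]
    conv_lhs => rw [hsplit.eq_prod_roots]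
    congr 1
    · rw [← hfK, leadingCoeff_map_of_injective (RingHom.injective_int _)]
      simp [ha]
    · rw [← Finset.prod_subtype (fQ.map (algebraMap ℚ K)).roots.toFinset (p := (· ∈ fQ.rootSet K))
        (by simp [rootSet, aroots]) (fun x => X - C x), Finset.prod_eq_multiset_prod,
        Multiset.toFinset_val, (nodup_roots hsepK).dedup]
  have hxint : ∀ x : fQ.rootSet K, ∃ b : 𝓞 K, (b : K) = a * x := by
    intro x
    have hx : aeval (x : K) f = 0 := by
      have := aeval_eq_zero_of_mem_rootSet x.2
      rwa [aeval_def, ← eval_map, ← hfK, eval_map, ← aeval_def] at this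
    have := isIntegral_leadingCoeff_smul f (x : K) hx
    exact ⟨⟨_, this⟩, by simp [ha]⟩
  choose b hb using hxint
  have hO : C (a : 𝓞 K) ^ Fintype.card (fQ.rootSet K) * f.map (algebraMap ℤ (𝓞 K)) =
      C (a : 𝓞 K) * ∏ x : fQ.rootSet K, (C (a : 𝓞 K) * X - C (b x)) := by
    apply map_injective (algebraMap (𝓞 K) K) (FaithfulSMul.algebraMap_injective _ _)
    rw [Polynomial.map_mul, Polynomial.map_pow, Polynomial.map_map, ← IsScalarTower.algebraMap_eq, hfac]
    simp only [Polynomial.map_mul, Polynomial.map_prod, Polynomial.map_sub, Polynomial.map_C,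
      Polynomial.map_X, hb,
      map_intCast (algebraMap (𝓞 K) K), map_mul]
    have : ∀ x : fQ.rootSet K, (C (a : K) * X - C (a : K) * C (x : K)) =
        C (a : K) * (X - C (x : K)) := fun x => by ring
    simp only [this, Finset.prod_mul_distrib, Finset.prod_const, Finset.card_univ]
    ring
  obtain ⟨k, _, _, hchar, φ, σ, hσ⟩ := exists_residueField_frobenius K p
  let _ : Algebra (ZMod p) k := ZMod.algebra _ p
  have hak : (a : k) ≠ 0 := by
    rw [Ne, CharP.intCast_eq_zero_iff _ p]
    exact hlc
  refine ⟨Gal.galActionHom fQ K (Gal.restrict fQ K σ), ⟨_, rfl⟩, ?_⟩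
  refine isCycle_of_lifts_frobenius (k := k) hu hg hd hf (a := (a : k))
    (fun x => φ (b x) / (a : k)) ?_ _ ?_
  · have h := congrArg (Polynomial.map φ) hO
    have hcomp : (f.map (Int.castRingHom (ZMod p))).map (algebraMap (ZMod p) (k)) =
        (f.map (algebraMap ℤ (𝓞 K))).map φ := by
      rw [Polynomial.map_map, Polynomial.map_map]
      congr 1
      exact RingHom.ext_int _ _
    rw [Polynomial.map_mul, Polynomial.map_pow, ← hcomp] at h
    simp only [Polynomial.map_mul, Polynomial.map_prod, Polynomial.map_sub, Polynomial.map_C,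
      Polynomial.map_X, map_intCast φ] at h
    have : ∀ x : fQ.rootSet K, (C (a : k) * X - C (φ (b x))) =
        C (a : k) * (X - C (φ (b x) / (a : k))) := fun x => by
      rw [mul_sub, ← C_mul, mul_div_cancel₀ _ hak]
    simp only [this, Finset.prod_mul_distrib, Finset.prod_const, Finset.card_univ] at h
    rw [← mul_assoc, mul_comm (C (a : k)), mul_assoc] at h
    have hdom : IsDomain k := inferInstance
    have hdomX : IsDomain k[X] := inferInstance
    refine mul_left_cancel₀ ?_ h
    exact pow_ne_zero _ (C_ne_zero.2 hak)
  · intro x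
    have h1 : b (Gal.galActionHom fQ K (Gal.restrict fQ K σ) x) = σ • b x := by
      apply FaithfulSMul.algebraMap_injective (𝓞 K) K
      rw [algebraMap.smul']
      simp only [hb]
      rw [Gal.galActionHom_restrict]
      simp
    have h3 : (a : k) ^ p = a := by
      rw [← map_intCast (algebraMap (ZMod p) (k)), ← map_pow, ZMod.pow_card]
    simp only [h1]
    rw [div_pow, h3, hσ]

open Polynomial in
/-- An integral polynomial that stays irreducible modulo a prime not dividing its leading
coefficient is irreducible over `ℚ`. -/
theorem irreducible_map_rat_of_irreducible_map_zmod {f : ℤ[X]} {p : ℕ} [Fact p.Prime]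
    (hlc : ¬ (p : ℤ) ∣ f.leadingCoeff) (hirr : Irreducible (f.map (Int.castRingHom (ZMod p)))) :
    Irreducible (f.map (Int.castRingHom ℚ)) := by
  have hf0 : f ≠ 0 := by rintro rfl; simp at hlc
  have hcont : ¬ (p : ℤ) ∣ f.content := fun h =>
    hlc (h.trans (content_dvd_coeff _))
  have hcz : ((f.content : ℤ) : ZMod p) ≠ 0 := by
    rwa [Ne, ZMod.intCast_zmod_eq_zero_iff_dvd]
  have hpp : Irreducible (f.primPart.map (Int.castRingHom (ZMod p))) := by
    rw [f.eq_C_content_mul_primPart, Polynomial.map_mul, Polynomial.map_C] at hirr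
    exact (irreducible_isUnit_mul (isUnit_C.2 (IsUnit.mk0 _ hcz))).1 hirr
  have hlcp : ¬ (p : ℤ) ∣ f.primPart.leadingCoeff := by
    intro h
    apply hlc
    rw [f.eq_C_content_mul_primPart, leadingCoeff_mul]
    exact h.mul_left _
  have key : ∀ a b : ℤ[X], f.primPart = a * b →
      IsUnit (a.map (Int.castRingHom (ZMod p))) → IsUnit a := by
    intro a b hab hu
    have hla : Int.castRingHom (ZMod p) a.leadingCoeff ≠ 0 := by
      intro h
      rw [eq_intCast, ZMod.intCast_zmod_eq_zero_iff_dvd] at h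
      apply hlcp
      rw [hab, leadingCoeff_mul]
      exact h.mul_right _
    have hdeg : a.natDegree = 0 := by
      rw [← natDegree_map_of_leadingCoeff_ne_zero _ hla]
      exact natDegree_eq_zero_of_isUnit hu
    rw [eq_C_of_natDegree_eq_zero hdeg]
    refine isUnit_C.2 (f.isPrimitive_primPart _ ?_)
    rw [← eq_C_of_natDegree_eq_zero hdeg, hab]
    exact dvd_mul_right _ _
  have hZ : Irreducible f.primPart := by
    refine ⟨fun h => hpp.not_isUnit (h.map (mapRingHom _)), fun a b hab => ?_⟩
    have := hab ▸ hpp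
    rw [Polynomial.map_mul] at this
    rcases this.isUnit_or_isUnit rfl with h | h
    · exact Or.inl (key a b hab h)
    · exact Or.inr (key b a (by rw [hab, mul_comm]) h)
  rw [f.eq_C_content_mul_primPart, Polynomial.map_mul, Polynomial.map_C]
  refine (irreducible_isUnit_mul (isUnit_C.2 (IsUnit.mk0 _ ?_))).2
    ((IsPrimitive.Int.irreducible_iff_irreducible_map_cast f.isPrimitive_primPart).1 hZ)
  simpa using fun h => hf0 (content_eq_zero_iff.1 h)

/-- The polynomial `v 0 X ^ n + v 1 X ^ (n - 1) + ⋯ + v n`. -/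
noncomputable def coeffPoly {n : ℕ} {R : Type*} [CommRing R] (v : Fin (n + 1) → R) :
    Polynomial R :=
  ∑ i : Fin (n + 1), Polynomial.C (v i) * Polynomial.X ^ (n - (i : ℕ))

section coeffPoly

open Polynomial

variable {n : ℕ} {R : Type*} [CommRing R]

theorem coeffPoly_map {S : Type*} [CommRing S] (φ : R →+* S) (v : Fin (n + 1) → R) :
    (coeffPoly v).map φ = coeffPoly (fun i => φ (v i)) := by
  simp [coeffPoly, Polynomial.map_sum]

theorem coeff_coeffPoly (v : Fin (n + 1) → R) (i : Fin (n + 1)) :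
    (coeffPoly v).coeff (n - i) = v i := by
  simp only [coeffPoly, finsetSum_coeff, coeff_C_mul, coeff_X_pow]
  rw [Finset.sum_eq_single i]
  · simp
  · intro b _ hb
    have : (n - (i : ℕ)) ≠ n - (b : ℕ) := fun h => hb (Fin.ext (by omega))
    simp [this]
  · simp

theorem natDegree_coeffPoly_le (v : Fin (n + 1) → R) : (coeffPoly v).natDegree ≤ n :=
  natDegree_sum_le_of_forall_le _ _ fun _ _ =>
    (natDegree_C_mul_X_pow_le _ _).trans (Nat.sub_le _ _)

theorem natDegree_coeffPoly {v : Fin (n + 1) → R} (hv : v 0 ≠ 0) :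
    (coeffPoly v).natDegree = n := by
  refine natDegree_eq_of_le_of_coeff_ne_zero (natDegree_coeffPoly_le v) ?_
  have := coeff_coeffPoly v 0
  simp only [Fin.val_zero, Nat.sub_zero] at this
  rwa [this]

theorem leadingCoeff_coeffPoly {v : Fin (n + 1) → R} (hv : v 0 ≠ 0) :
    (coeffPoly v).leadingCoeff = v 0 := by
  rw [leadingCoeff, natDegree_coeffPoly hv]
  simpa using coeff_coeffPoly v 0

theorem exists_coeffPoly_eq {f : R[X]} (hf : f.natDegree ≤ n) :
    ∃ v : Fin (n + 1) → R, coeffPoly v = f := by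
  refine ⟨fun i => f.coeff (n - i), ?_⟩
  ext k
  rcases le_or_gt k n with hk | hk
  · have := coeff_coeffPoly (fun i : Fin (n + 1) => f.coeff (n - i)) ⟨n - k, by omega⟩
    simpa only [Nat.sub_sub_self hk] using this
  · rw [coeff_eq_zero_of_natDegree_lt ((natDegree_coeffPoly_le _).trans_lt hk),
      coeff_eq_zero_of_natDegree_lt (hf.trans_lt hk)]

end coeffPoly

open Polynomial in
/-- The reduced coefficient vector `v` defines a polynomial of degree `n` that is the product of a
constant, a monic irreducible of degree `d` and distinct linear factors. -/
def HasFactorType {n : ℕ} (p d : ℕ) (v : Fin (n + 1) → ZMod p) : Prop :=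
  ∃ (u : ZMod p) (g : (ZMod p)[X]) (S : Finset (ZMod p)), u ≠ 0 ∧ g.Monic ∧ Irreducible g ∧
    g.natDegree = d ∧ #S = n - d ∧ coeffPoly v = C u * g * ∏ s ∈ S, (X - C s)

theorem HasFactorType.zero_ne_zero {n p d : ℕ} [Fact p.Prime] {v : Fin (n + 1) → ZMod p}
    (hd : d ≤ n) (h : HasFactorType p d v) : v 0 ≠ 0 := by
  obtain ⟨u, g, S, hu, hgm, hg, hgd, hS, hv⟩ := h
  have h1 : (coeffPoly v).natDegree = n := by
    rw [hv, mul_assoc, Polynomial.natDegree_C_mul hu, hgm.natDegree_mul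
      (Polynomial.monic_prod_of_monic _ _ fun s _ => Polynomial.monic_X_sub_C s), hgd,
      Polynomial.natDegree_prod_of_monic _ _ fun s _ => Polynomial.monic_X_sub_C s]
    simp only [Polynomial.natDegree_X_sub_C, Finset.sum_const, smul_eq_mul, mul_one, hS]
    omega
  have h2 : (coeffPoly v).leadingCoeff = u := by
    rw [hv, mul_assoc, Polynomial.leadingCoeff_mul, Polynomial.leadingCoeff_C,
      (hgm.mul (Polynomial.monic_prod_of_monic _ _ fun s _ =>
        Polynomial.monic_X_sub_C s)).leadingCoeff, mul_one]
  have h3 := coeff_coeffPoly v 0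
  rw [Polynomial.leadingCoeff, h1] at h2
  simp only [Fin.val_zero, Nat.sub_zero, h2] at h3
  exact h3 ▸ hu

theorem formPolyX_eq_map {n : ℕ} (R : Type*) [CommRing R] (c : Fin (n + 1) → ℤ) :
    formPolyX R c = (coeffPoly c).map (Int.castRingHom R) := by
  rw [coeffPoly_map]; rfl

theorem MvPolynomial.natDegree_aeval_X_one_le {R : Type*} [CommRing R]
    (a : MvPolynomial (Fin 2) R) :
    (MvPolynomial.aeval ![(Polynomial.X : Polynomial R), 1] a).natDegree ≤ a.totalDegree := by
  rw [MvPolynomial.aeval_def, MvPolynomial.eval₂_eq']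
  refine Polynomial.natDegree_sum_le_of_forall_le _ _ fun m hm => ?_
  simp only [Fin.prod_univ_two, Matrix.cons_val_zero, Matrix.cons_val_one, one_pow, mul_one]
  refine (Polynomial.natDegree_C_mul_X_pow_le _ _).trans ?_
  refine le_trans ?_ (MvPolynomial.le_totalDegree hm)
  rw [Finsupp.sum_fintype _ _ (by simp), Fin.sum_univ_two]
  omega

theorem irreducible_formPoly {n : ℕ} {c : Fin (n + 1) → ℤ} (h0 : c 0 ≠ 0)
    (h : Irreducible (formPolyX ℚ c)) : Irreducible (formPoly ℚ c) := by
  have hev : MvPolynomial.aeval ![(Polynomial.X : Polynomial ℚ), 1] (formPoly ℚ c) =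
      formPolyX ℚ c := by
    simp [formPoly, formPolyR, formPolyX]
  have hdegX : (formPolyX ℚ c).natDegree = n :=
    natDegree_coeffPoly (v := fun i => (c i : ℚ)) (by simpa using h0)
  have hdeg : (formPoly ℚ c).totalDegree ≤ n := by
    refine MvPolynomial.totalDegree_finsetSum_le fun i _ => ?_
    refine (MvPolynomial.totalDegree_mul _ _).trans ?_
    refine (add_le_add_left (MvPolynomial.totalDegree_mul _ _) _).trans ?_
    rw [MvPolynomial.totalDegree_C, MvPolynomial.totalDegree_X_pow,
      MvPolynomial.totalDegree_X_pow]
    omega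
  have key : ∀ a b : MvPolynomial (Fin 2) ℚ, formPoly ℚ c = a * b →
      IsUnit (MvPolynomial.aeval ![(Polynomial.X : Polynomial ℚ), 1] a) → IsUnit a := by
    intro a b hab hu
    have hne : formPoly ℚ c ≠ 0 := by
      intro h0
      rw [h0, map_zero] at hev
      exact h.ne_zero hev.symm
    rw [hab] at hne hdeg hev
    rw [MvPolynomial.totalDegree_mul_of_isDomain (left_ne_zero_of_mul hne)
      (right_ne_zero_of_mul hne)] at hdeg
    rw [map_mul] at hev
    have h1 := MvPolynomial.natDegree_aeval_X_one_le b
    have h2 := Polynomial.natDegree_eq_zero_of_isUnit hu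
    have h3 := congrArg Polynomial.natDegree hev
    rw [hdegX, Polynomial.natDegree_mul (by rintro h; simp [h] at hu)
      (by rintro h'; rw [h', mul_zero] at hev; exact h.ne_zero hev.symm), h2] at h3
    have h4 : a.totalDegree = 0 := by omega
    rw [MvPolynomial.totalDegree_eq_zero_iff_eq_C] at h4
    rw [h4]
    refine IsUnit.map _ (IsUnit.mk0 _ fun h5 => left_ne_zero_of_mul hne ?_)
    rw [h4, h5, map_zero]
  refine ⟨fun hu => h.not_isUnit (hev ▸ hu.map _), fun a b hab => ?_⟩
  rw [hab, map_mul] at hev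
  rcases h.isUnit_or_isUnit hev.symm with h' | h'
  · exact Or.inl (key a b hab h')
  · exact Or.inr (key b a (by rw [hab, mul_comm]) h')

open Polynomial in
theorem irreducible_and_gal_of_hasFactorType {n : ℕ} (hn : 3 ≤ n) {c : Fin (n + 1) → ℤ}
    {p q r : ℕ} (hp : p.Prime) (hq : q.Prime) (hr : r.Prime)
    (h1 : HasFactorType p n (fun i => (c i : ZMod p)))
    (h2 : HasFactorType q (n - 1) (fun i => (c i : ZMod q)))
    (h3 : HasFactorType r 2 (fun i => (c i : ZMod r))) :
    Irreducible (formPoly ℚ c) ∧ Nonempty ((formPolyX ℚ c).Gal ≃* Equiv.Perm (Fin n)) := by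
  classical
  have hlc : ∀ {p d : ℕ}, p.Prime → d ≤ n → HasFactorType p d (fun i => (c i : ZMod p)) →
      ¬ (p : ℤ) ∣ c 0 := by
    intro p d hp hd h
    have := Fact.mk hp
    have := h.zero_ne_zero hd
    rwa [Ne, ZMod.intCast_zmod_eq_zero_iff_dvd] at this
  have h0 : c 0 ≠ 0 := fun h => hlc hp le_rfl h1 (h ▸ dvd_zero _)
  have hlead : (coeffPoly c).leadingCoeff = c 0 := leadingCoeff_coeffPoly h0
  have hirr : Irreducible (formPolyX ℚ c) := by
    have := Fact.mk hp
    rw [formPolyX_eq_map]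
    refine irreducible_map_rat_of_irreducible_map_zmod (p := p)
      (hlead ▸ hlc hp le_rfl h1) ?_
    obtain ⟨u, g, S, hu, -, hg, hgd, hS, hv⟩ := h1
    rw [Nat.sub_self, Finset.card_eq_zero] at hS
    rw [coeffPoly_map]
    simp only [eq_intCast]
    rw [hv, hS, Finset.prod_empty, mul_one]
    exact (irreducible_isUnit_mul (isUnit_C.2 hu.isUnit)).2 hg
  refine ⟨irreducible_formPoly h0 hirr, ?_⟩
  have hsep := hirr.separable
  let K := (formPolyX ℚ c).SplittingField
  have hK : IsSplittingField ℚ K (formPolyX ℚ c) := IsSplittingField.splittingField _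
  have : FiniteDimensional ℚ K := IsSplittingField.finiteDimensional K (formPolyX ℚ c)
  have : CharZero K := algebraRat.charZero K
  have : NumberField K := {}
  have hgal : IsGalois ℚ K := IsGalois.of_separable_splitting_field hsep
  have hsplits : (((coeffPoly c).map (Int.castRingHom ℚ)).map (algebraMap ℚ K)).Splits := by
    rw [← formPolyX_eq_map]
    exact SplittingField.splits _
  have hF : Fact (((coeffPoly c).map (Int.castRingHom ℚ)).map (algebraMap ℚ K)).Splits := ⟨hsplits⟩
  have hcyc : ∀ {p d : ℕ}, p.Prime → 2 ≤ d → d ≤ n →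
      HasFactorType p d (fun i => (c i : ZMod p)) →
      ∃ τ ∈ (Gal.galActionHom ((coeffPoly c).map (Int.castRingHom ℚ)) K).range,
        τ.IsCycle ∧ #τ.support = d := by
    intro p d hp h2d hd h
    have := Fact.mk hp
    have hl := hlc hp hd h
    obtain ⟨u, g, S, hu, -, hg, hgd, hS, hv⟩ := h
    have := exists_gal_isCycle (K := K) (f := coeffPoly c) (formPolyX_eq_map ℚ c ▸ hsep)
      (hlead ▸ hl) hu hg (hgd ▸ h2d) (S := S) (by rw [coeffPoly_map]; exact hv)
    rwa [hgd] at this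
  have hcard : Fintype.card (((coeffPoly c).map (Int.castRingHom ℚ)).rootSet K) = n := by
    rw [card_rootSet_eq_natDegree (formPolyX_eq_map ℚ c ▸ hsep) hsplits,
      natDegree_map_eq_of_injective (RingHom.injective_int _), natDegree_coeffPoly h0]
  obtain ⟨σ, hσ, hσc, hσn⟩ := hcyc hp (by omega) le_rfl h1
  obtain ⟨τ, hτ, hτc, hτn⟩ := hcyc hq (by omega) (by omega) h2
  obtain ⟨ρ, hρ, -, hρn⟩ := hcyc hr le_rfl (by omega) h3
  have htop := Subgroup.eq_top_of_isCycle_card _ (by omega) hσ hτ hρ hσc (by omega) hτc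
    (by omega) hρn
  have e : ((coeffPoly c).map (Int.castRingHom ℚ)).Gal ≃*
      Equiv.Perm (((coeffPoly c).map (Int.castRingHom ℚ)).rootSet K) :=
    MulEquiv.ofBijective (Gal.galActionHom _ K) ⟨Gal.galActionHom_injective _ K,
      MonoidHom.range_eq_top.1 htop⟩
  rw [formPolyX_eq_map]
  exact ⟨e.trans (Fintype.equivFinOfCardEq hcard).permCongrHom⟩

open IntermediateField in
theorem pow_card_pow_natDegree_minpoly {p : ℕ} [Fact p.Prime] {L : Type*} [Field L] [Finite L]
    [Algebra (ZMod p) L] (x : L) : x ^ p ^ (minpoly (ZMod p) x).natDegree = x := by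
  have hx : IsIntegral (ZMod p) x := IsIntegral.of_finite _ _
  have hc : Nat.card (ZMod p)⟮x⟯ = p ^ (minpoly (ZMod p) x).natDegree := by
    rw [Module.natCard_eq_pow_finrank (K := ZMod p), adjoin.finrank hx, Nat.card_zmod]
  have := Fintype.ofFinite (ZMod p)⟮x⟯
  have h := FiniteField.pow_card (AdjoinSimple.gen (ZMod p) x)
  rw [← Nat.card_eq_fintype_card, hc] at h
  simpa using congrArg (algebraMap (ZMod p)⟮x⟯ L) h

theorem two_mul_sum_pow_lt {p : ℕ} (hp : 3 ≤ p) (d : ℕ) :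
    2 * ∑ k ∈ range d, p ^ k < p ^ d := by
  induction d with
  | zero => simp
  | succ d ih =>
    rw [Finset.sum_range_succ, pow_succ]
    have := Nat.mul_le_mul_left (p ^ d) hp
    omega

open Polynomial in
/-- There are at least `p ^ d / (2 * d)` monic irreducibles of degree `d` over `𝔽_p`. -/
theorem exists_finset_monic_irreducible {p : ℕ} [Fact p.Prime] (hp : 3 ≤ p) {d : ℕ} (hd : d ≠ 0) :
    ∃ M : Finset (ZMod p)[X], (∀ g ∈ M, g.Monic ∧ Irreducible g ∧ g.natDegree = d) ∧
      p ^ d ≤ 2 * d * #M := by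
  classical
  let L := GaloisField p d
  have := Fintype.ofFinite L
  have hxint : ∀ x : L, IsIntegral (ZMod p) x := fun x => IsIntegral.of_finite _ _
  let E : Finset L := {x | (minpoly (ZMod p) x).natDegree = d}
  have hle : ∀ x : L, (minpoly (ZMod p) x).natDegree ≤ d := fun x =>
    (minpoly.natDegree_le x).trans (GaloisField.finrank p hd).le
  have hcardL : Fintype.card L = p ^ d := by
    rw [← Nat.card_eq_fintype_card, GaloisField.card p d hd]
  have hEc : #Eᶜ ≤ ∑ k ∈ range d, p ^ k := by
    have hsub : Eᶜ ⊆ (range d).biUnion fun k =>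
        if k = 0 then ∅ else (X ^ p ^ k - X : L[X]).roots.toFinset := by
      intro x hx
      have h1 : (minpoly (ZMod p) x).natDegree < d :=
        lt_of_le_of_ne (hle x) (by simpa [E] using hx)
      have h2 : (minpoly (ZMod p) x).natDegree ≠ 0 := (minpoly.natDegree_pos (hxint x)).ne'
      refine mem_biUnion.2 ⟨_, mem_range.2 h1, ?_⟩
      rw [if_neg h2, Multiset.mem_toFinset, mem_roots
        (FiniteField.X_pow_card_pow_sub_X_ne_zero L h2 (by omega))]
      simp [pow_card_pow_natDegree_minpoly]
    refine (card_le_card hsub).trans (card_biUnion_le.trans (Finset.sum_le_sum fun k _ => ?_))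
    split_ifs with hk
    · simp
    · refine (Multiset.toFinset_card_le _).trans ((card_roots' _).trans ?_)
      rw [FiniteField.X_pow_card_pow_sub_X_natDegree_eq L hk (by omega)]
  have hE : p ^ d ≤ 2 * #E := by
    have h1 := Finset.card_compl_add_card E
    have h2 := two_mul_sum_pow_lt hp d
    omega
  refine ⟨E.image (minpoly (ZMod p)), ?_, ?_⟩
  · intro g hg
    obtain ⟨x, hx, rfl⟩ := mem_image.1 hg
    exact ⟨minpoly.monic (hxint x), minpoly.irreducible (hxint x), by simpa [E] using hx⟩
  · have := Finset.card_le_mul_card_image (f := minpoly (ZMod p)) E d (by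
      intro g hg
      obtain ⟨y, hy, rfl⟩ := mem_image.1 hg
      have hy0 := minpoly.ne_zero (hxint y)
      have hdeg : (minpoly (ZMod p) y).natDegree = d := by simpa [E] using hy
      calc #{a ∈ E | minpoly (ZMod p) a = minpoly (ZMod p) y}
          ≤ #((minpoly (ZMod p) y).aroots L).toFinset := by
            refine card_le_card fun a ha => ?_
            rw [Multiset.mem_toFinset, mem_aroots]
            refine ⟨hy0, ?_⟩
            rw [← (mem_filter.1 ha).2]
            exact minpoly.aeval _ _
        _ ≤ d := by
            refine (Multiset.toFinset_card_le _).trans ((card_roots' _).trans ?_)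
            rw [natDegree_map, hdeg])
    calc p ^ d ≤ 2 * #E := hE
      _ ≤ 2 * d * _ := by rw [mul_assoc]; exact Nat.mul_le_mul_left _ this

open Polynomial in
theorem card_mul_choose_le_card_hasFactorType {n d p : ℕ} [Fact p.Prime] (hd : 2 ≤ d)
    (hdn : d ≤ n) (M : Finset (ZMod p)[X])
    (hM : ∀ g ∈ M, g.Monic ∧ Irreducible g ∧ g.natDegree = d) :
    (p - 1) * (#M * p.choose (n - d)) ≤
      Nat.card {v : Fin (n + 1) → ZMod p // HasFactorType p d v} := by
  classical
  let T : Finset (ZMod p × (ZMod p)[X] × Finset (ZMod p)) :=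
    (univ.erase 0) ×ˢ M ×ˢ powersetCard (n - d) univ
  have hT : #T = (p - 1) * (#M * p.choose (n - d)) := by
    simp only [T, card_product, card_powersetCard, card_univ, ZMod.card]
    rw [card_erase_of_mem (mem_univ _), card_univ, ZMod.card]
  let P : ZMod p × (ZMod p)[X] × Finset (ZMod p) → (ZMod p)[X] := fun t =>
    C t.1 * t.2.1 * ∏ s ∈ t.2.2, (X - C s)
  have hmem : ∀ t, t ∈ T ↔ t.1 ≠ 0 ∧ t.2.1 ∈ M ∧ #t.2.2 = n - d := by
    intro t; simp [T, mem_powersetCard]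
  have hprod : ∀ S : Finset (ZMod p), (∏ s ∈ S, (X - C s)).Monic := fun S =>
    monic_prod_of_monic _ _ fun s _ => monic_X_sub_C s
  have hex : ∀ t, ∃ v : Fin (n + 1) → ZMod p, t ∈ T → coeffPoly v = P t := by
    intro t
    by_cases ht : t ∈ T
    · obtain ⟨h0, hg, hS⟩ := (hmem t).1 ht
      obtain ⟨v, hv⟩ := exists_coeffPoly_eq (n := n) (f := P t) (by
        simp only [P]
        rw [mul_assoc, natDegree_C_mul h0, (hM _ hg).1.natDegree_mul (hprod _), (hM _ hg).2.2,
          natDegree_prod_of_monic _ _ fun s _ => monic_X_sub_C s]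
        simp only [natDegree_X_sub_C, Finset.sum_const, smul_eq_mul, mul_one, hS]
        omega)
      exact ⟨v, fun _ => hv⟩
    · exact ⟨0, fun h => absurd h ht⟩
  choose F hF using hex
  rw [← hT, Nat.card_eq_fintype_card, Fintype.card_subtype]
  refine Finset.card_le_card_of_injOn F ?_ ?_
  · intro t ht
    obtain ⟨h0, hg, hS⟩ := (hmem t).1 ht
    simp only [coe_filter, mem_univ, true_and, Set.mem_ofPred_eq]
    exact ⟨t.1, t.2.1, t.2.2, h0, (hM _ hg).1, (hM _ hg).2.1, (hM _ hg).2.2, hS, hF t ht⟩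
  · intro t ht t' ht' htt
    have hPP : P t = P t' := by rw [← hF t ht, ← hF t' ht', htt]
    obtain ⟨h0, hg, hS⟩ := (hmem t).1 ht
    obtain ⟨h0', hg', hS'⟩ := (hmem t').1 ht'
    have hlead : ∀ t, t ∈ T → (P t).leadingCoeff = t.1 := by
      intro t ht
      obtain ⟨h0, hg, hS⟩ := (hmem t).1 ht
      simp only [P]
      rw [mul_assoc, leadingCoeff_mul, leadingCoeff_C, ((hM _ hg).1.mul (hprod _)).leadingCoeff,
        mul_one]
    have hroot : ∀ t, t ∈ T → ∀ s, (P t).IsRoot s ↔ s ∈ t.2.2 := by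
      intro t ht s
      obtain ⟨h0, hg, hS⟩ := (hmem t).1 ht
      have hgs : ¬ t.2.1.IsRoot s := by
        intro h
        have := degree_eq_one_of_irreducible_of_root (hM _ hg).2.1 h
        have : t.2.1.natDegree = 1 := natDegree_eq_of_degree_eq_some this
        have := (hM _ hg).2.2
        omega
      simp only [P, IsRoot.def] at hgs ⊢
      simp only [eval_mul, eval_C, eval_prod, eval_sub, eval_X, mul_eq_zero, h0, hgs, false_or,
        Finset.prod_eq_zero_iff, sub_eq_zero]
      simp
    have e1 : t.1 = t'.1 := by rw [← hlead t ht, hPP, hlead t' ht']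
    have e3 : t.2.2 = t'.2.2 := by
      ext s
      rw [← hroot t ht, hPP, hroot t' ht']
    have e2 : t.2.1 = t'.2.1 := by
      simp only [P, e1, e3] at hPP
      exact mul_left_cancel₀ (C_ne_zero.2 h0') (mul_right_cancel₀ (hprod _).ne_zero hPP)
    exact Prod.ext e1 (Prod.ext e2 e3)

theorem exists_le_card_hasFactorType {n d : ℕ} (hd : 2 ≤ d) (hdn : d ≤ n) :
    ∃ δ : ℝ, 0 < δ ∧ ∃ P : ℕ, ∀ p : ℕ, p.Prime → P ≤ p →
      δ * (p : ℝ) ^ (n + 1) ≤ Nat.card {v : Fin (n + 1) → ZMod p // HasFactorType p d v} := by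
  set m := n - d with hm
  refine ⟨1 / (4 * d * (2 ^ m * (m.factorial : ℝ))), by positivity, 3 + 2 * m, fun p hp hP => ?_⟩
  have := Fact.mk hp
  obtain ⟨M, hM, hMc⟩ := exists_finset_monic_irreducible (p := p) (by omega) (d := d) (by omega)
  have h1 := card_mul_choose_le_card_hasFactorType hd hdn M hM
  refine le_trans ?_ (Nat.cast_le.2 h1)
  have hch : ((p : ℝ) / 2) ^ m / m.factorial ≤ p.choose m := by
    refine le_trans ?_ (Nat.pow_le_choose (α := ℝ) m p)
    gcongr
    rw [Nat.cast_sub (by omega)]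
    have : (2 * m : ℝ) ≤ p := by exact_mod_cast (by omega : 2 * m ≤ p)
    push_cast
    linarith
  have hMc' : (p : ℝ) ^ d / (2 * d) ≤ #M := by
    rw [div_le_iff₀ (by positivity), mul_comm]
    exact_mod_cast hMc
  have hp1 : (p : ℝ) / 2 ≤ ((p - 1 : ℕ) : ℝ) := by
    rw [Nat.cast_sub (by omega)]
    have : (3 : ℝ) ≤ p := by exact_mod_cast (by omega : 3 ≤ p)
    push_cast
    linarith
  push_cast [← hm]
  calc 1 / (4 * d * (2 ^ m * (m.factorial : ℝ))) * (p : ℝ) ^ (n + 1)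
      = (p : ℝ) / 2 * ((p : ℝ) ^ d / (2 * d) * (((p : ℝ) / 2) ^ m / m.factorial)) := by
        rw [show n + 1 = 1 + d + m by omega, pow_add, pow_add, div_pow]
        field_simp
        ring
    _ ≤ _ := by gcongr

theorem exists_finset_primes_ge (P k : ℕ) :
    ∃ Q : Finset ℕ, #Q = k ∧ ∀ q ∈ Q, q.Prime ∧ P ≤ q := by
  have hinf : {p : ℕ | p.Prime ∧ P ≤ p}.Infinite := by
    rw [Set.infinite_iff_exists_gt]
    intro a
    obtain ⟨p, hp, hpp⟩ := Nat.exists_infinite_primes (a + 1 + P)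
    exact ⟨p, ⟨hpp, by omega⟩, by omega⟩
  obtain ⟨Q, hQ, hk⟩ := hinf.exists_subset_card_eq k
  exact ⟨Q, hk, fun q hq => hQ hq⟩

theorem tendsto_card_halfBox_no_factorType {n d : ℕ} (hd : 2 ≤ d) (hdn : d ≤ n) :
    Filter.Tendsto (fun X : ℝ => (Set.ncard {c | c ∈ halfBox n X ∧
      ∀ p : ℕ, p.Prime → ¬ HasFactorType p d (fun i => (c i : ZMod p))} : ℝ) / X ^ (n + 1))
      Filter.atTop (nhds 0) := by
  classical
  obtain ⟨δ, hδ, P, hP⟩ := exists_le_card_hasFactorType hd hdn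
  have hfac : ∀ q : ℕ, q.Prime → P ≤ q →
      (Nat.card {v : Fin (n + 1) → ZMod q | ¬ HasFactorType q d v} : ℝ) / (q : ℝ) ^ (n + 1) ≤
        1 - δ := by
    intro q hq hPq
    have := Fact.mk hq
    have hq0 : (0 : ℝ) < (q : ℝ) ^ (n + 1) := pow_pos (Nat.cast_pos.2 hq.pos) _
    have h1 := hP q hq hPq
    have h2 : Nat.card {v : Fin (n + 1) → ZMod q // HasFactorType q d v} +
        Nat.card {v : Fin (n + 1) → ZMod q | ¬ HasFactorType q d v} = q ^ (n + 1) := by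
      rw [Nat.card_eq_fintype_card, Nat.card_eq_fintype_card]
      have h := Fintype.card_subtype_compl (fun v : Fin (n + 1) → ZMod q => HasFactorType q d v)
      have h' := Fintype.card_subtype_le (fun v : Fin (n + 1) → ZMod q => HasFactorType q d v)
      have h3 : Fintype.card (Fin (n + 1) → ZMod q) = q ^ (n + 1) := by simp [ZMod.card]
      rw [← h3]
      change _ + Fintype.card {v : Fin (n + 1) → ZMod q // ¬ HasFactorType q d v} = _
      omega
    have h3 : (Nat.card {v : Fin (n + 1) → ZMod q // HasFactorType q d v} : ℝ) +
        Nat.card {v : Fin (n + 1) → ZMod q | ¬ HasFactorType q d v} = (q : ℝ) ^ (n + 1) := by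
      exact_mod_cast h2
    rw [div_le_iff₀ hq0]
    linarith
  have hδ1 : 0 ≤ 1 - δ := by
    obtain ⟨q, hPq, hq⟩ := Nat.exists_infinite_primes P
    exact le_trans (by positivity) (hfac q hq hPq)
  rw [Metric.tendsto_atTop]
  intro ε hε
  obtain ⟨k, hk⟩ := exists_pow_lt_of_lt_one (show 0 < ε / 2 ^ n by positivity)
    (show 1 - δ < 1 by linarith)
  obtain ⟨Q, hQk, hQ⟩ := exists_finset_primes_ge P k
  have hA := tendsto_card_halfBox_forall_mem n Q (fun q => q) (fun q hq => (hQ q hq).1.pos)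
    (fun p hp q hq hpq => (Nat.coprime_primes (hQ p hp).1 (hQ q hq).1).2 hpq)
    (fun q => {v | ¬ HasFactorType q d v})
  have hlim : (2 : ℝ) ^ n * ∏ q ∈ Q,
      ((Nat.card {v : Fin (n + 1) → ZMod q | ¬ HasFactorType q d v} : ℝ) /
        (q : ℝ) ^ (n + 1)) < ε := by
    calc _ ≤ (2 : ℝ) ^ n * (1 - δ) ^ k := by
          gcongr
          rw [← hQk, ← Finset.prod_const]
          exact Finset.prod_le_prod (fun q _ => by positivity)
            fun q hq => hfac q (hQ q hq).1 (hQ q hq).2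
      _ < ε := by
          rw [lt_div_iff₀ (by positivity)] at hk
          linarith
  obtain ⟨N, hN⟩ := Filter.eventually_atTop.1 (hA.eventually_lt_const hlim)
  refine ⟨max N 1, fun X hX => ?_⟩
  have hX1 : 0 < X := lt_of_lt_of_le one_pos ((le_max_right _ _).trans hX)
  rw [Real.dist_eq, sub_zero, abs_of_nonneg (by positivity)]
  refine lt_of_le_of_lt ?_ (hN X ((le_max_left _ _).trans hX))
  refine div_le_div_of_nonneg_right (Nat.cast_le.2 (Set.ncard_le_ncard ?_ ?_)) (by positivity)
  · exact fun c hc => ⟨hc.1, fun q hq => hc.2 q (hQ q hq).1⟩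
  · exact (halfBox_finite n X).subset fun c hc => hc.1

theorem tendsto_card_halfBox_not_irreducible_gal {n : ℕ} (hn : 3 ≤ n) :
    Filter.Tendsto (fun X : ℝ => (Set.ncard {c | c ∈ halfBox n X ∧
      ¬ (Irreducible (formPoly ℚ c) ∧ Nonempty ((formPolyX ℚ c).Gal ≃* Equiv.Perm (Fin n)))} : ℝ) /
        X ^ (n + 1)) Filter.atTop (nhds 0) := by
  have h := ((tendsto_card_halfBox_no_factorType (n := n) (d := n) (by omega) le_rfl).add
    (tendsto_card_halfBox_no_factorType (n := n) (d := n - 1) (by omega) (by omega))).add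
    (tendsto_card_halfBox_no_factorType (n := n) (d := 2) le_rfl (by omega))
  simp only [add_zero] at h
  refine squeeze_zero' ?_ ?_ h
  · filter_upwards [Filter.eventually_gt_atTop 0] with X hX
    positivity
  · filter_upwards [Filter.eventually_gt_atTop 0] with X hX
    rw [← add_div, ← add_div]
    gcongr
    norm_cast
    have hfin : ∀ d, {c | c ∈ halfBox n X ∧
        ∀ p : ℕ, p.Prime → ¬ HasFactorType p d (fun i => (c i : ZMod p))}.Finite := fun d =>
      (halfBox_finite n X).subset fun c hc => hc.1
    refine (Set.ncard_le_ncard ?_ (((hfin n).union (hfin (n - 1))).union (hfin 2))).trans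
      ((Set.ncard_union_le _ _).trans (Nat.add_le_add_right (Set.ncard_union_le _ _) _))
    rintro c ⟨hc, hbad⟩
    by_contra hcon
    simp only [Set.mem_union, Set.mem_ofPred_eq, hc, true_and, not_or, not_forall, not_not] at hcon
    obtain ⟨⟨⟨p, hp, h1⟩, ⟨q, hq, h2⟩⟩, ⟨r, hr, h3⟩⟩ := hcon
    exact hbad (irreducible_and_gal_of_hasFactorType hn hp hq hr h1 h2 h3)

/-- The integers of absolute value at most `Y`. -/
noncomputable abbrev symIcc (Y : ℕ) : Finset ℤ := Icc (-(Y : ℤ)) Y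

theorem card_filter_cast_eq_le (Y p : ℕ) (b : ZMod p) :
    #{y ∈ symIcc Y | ((y : ℤ) : ZMod p) = b} ≤ 2 * Y / p + 1 := by
  have h : ∀ y ∈ symIcc Y, ((y + Y).toNat / p) ∈ range (2 * Y / p + 1) := by
    intro y hy
    rw [mem_Icc] at hy
    rw [mem_range, Nat.lt_succ_iff]
    exact Nat.div_le_div_right (by omega)
  rw [← card_range (2 * Y / p + 1)]
  refine card_le_card_of_injOn (fun y => (y + Y).toNat / p)
    (fun y hy => h y (mem_filter.1 hy).1) ?_
  intro y hy z hz hyz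
  simp only [coe_filter, mem_Icc, Set.mem_ofPred_eq] at hy hz
  obtain ⟨u, hu⟩ := Int.eq_ofNat_of_zero_le (a := y + Y) (by omega)
  obtain ⟨v, hv⟩ := Int.eq_ofNat_of_zero_le (a := z + Y) (by omega)
  simp only [hu, hv, Int.toNat_natCast] at hyz
  have huv : (u : ZMod p) = v := by
    have h1 : ((u : ℤ) : ZMod p) = ((v : ℤ) : ZMod p) := by
      rw [← hu, ← hv]; push_cast; rw [hy.2, hz.2]
    exact_mod_cast h1
  rw [ZMod.natCast_eq_natCast_iff'] at huv
  have : u = v := by rw [← Nat.div_add_mod u p, ← Nat.div_add_mod v p, hyz, huv]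
  omega

theorem card_filter_eval_eq_zero_le (Y : ℕ) {p : ℕ} [Fact p.Prime] {F : Polynomial (ZMod p)}
    (hF : F ≠ 0) :
    #{y ∈ symIcc Y | F.eval ((y : ℤ) : ZMod p) = 0} ≤ F.natDegree * (2 * Y / p + 1) := by
  have hp := (Fact.out : p.Prime)
  calc #{y ∈ symIcc Y | F.eval ((y : ℤ) : ZMod p) = 0}
      ≤ (2 * Y / p + 1) *
        #(image (fun y : ℤ => ((y : ℤ) : ZMod p)) {y ∈ symIcc Y | F.eval ((y : ℤ) : ZMod p) = 0}) := by
        refine card_le_mul_card_image _ _ fun b _ => le_trans (card_le_card ?_)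
          (card_filter_cast_eq_le Y p b)
        intro y hy
        simp only [mem_filter] at hy ⊢
        exact ⟨hy.1.1, hy.2⟩
    _ ≤ (2 * Y / p + 1) * F.natDegree := by
        gcongr
        refine le_trans (card_le_card ?_) (F.roots.toFinset_card_le.trans F.card_roots')
        intro b hb
        obtain ⟨y, hy, rfl⟩ := mem_image.1 hb
        simpa [hF] using (mem_filter.1 hy).2
    _ = _ := mul_comm _ _

theorem card_filter_mvEval_eq_zero_mul_le {R : Type*} [CommRing R] [IsDomain R] [DecidableEq R]
    {m : ℕ} {r : MvPolynomial (Fin m) R} (hr : r ≠ 0) (S : Finset R) :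
    #{x ∈ Fintype.piFinset fun _ : Fin m => S | MvPolynomial.eval x r = 0} * #S ≤
      r.totalDegree * #S ^ m := by
  have h := MvPolynomial.schwartz_zippel_totalDegree hr S
  rcases S.eq_empty_or_nonempty with rfl | hS
  · simp
  · have hS' : (0 : ℚ≥0) < #S := by exact_mod_cast hS.card_pos
    rw [div_le_div_iff₀ (by positivity) hS'] at h
    exact_mod_cast h

theorem card_filter_mvEval_cast_eq_zero_mul_le (Y : ℕ) {p m : ℕ} [Fact p.Prime]
    {r : MvPolynomial (Fin m) (ZMod p)} (hr : r ≠ 0) :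
    #{x ∈ Fintype.piFinset fun _ : Fin m => symIcc Y |
      MvPolynomial.eval (fun i => (x i : ZMod p)) r = 0} * p ≤
      r.totalDegree * p ^ m * (2 * Y / p + 1) ^ m := by
  have hp := (Fact.out : p.Prime)
  have h1 := card_filter_mvEval_eq_zero_mul_le hr univ
  rw [card_univ, ZMod.card] at h1
  have h2 : #{x ∈ Fintype.piFinset fun _ : Fin m => symIcc Y |
      MvPolynomial.eval (fun i => (x i : ZMod p)) r = 0} ≤ (2 * Y / p + 1) ^ m *
      #{x ∈ Fintype.piFinset fun _ : Fin m => (univ : Finset (ZMod p)) |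
        MvPolynomial.eval x r = 0} := by
    refine (card_le_mul_card_image (f := fun x : Fin m → ℤ => fun i => (x i : ZMod p)) _ _
      fun b _ => ?_).trans (Nat.mul_le_mul_left _ (card_le_card ?_))
    · calc _ ≤ #(Fintype.piFinset fun i => {y ∈ symIcc Y | ((y : ℤ) : ZMod p) = b i}) := by
            refine card_le_card fun x hx => ?_
            simp only [mem_filter, Fintype.mem_piFinset] at hx ⊢
            exact fun i => ⟨hx.1.1 i, congrFun hx.2 i⟩
        _ = ∏ i, #{y ∈ symIcc Y | ((y : ℤ) : ZMod p) = b i} := Fintype.card_piFinset _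
        _ ≤ ∏ i : Fin m, (2 * Y / p + 1) :=
            prod_le_prod' fun i _ => card_filter_cast_eq_le Y p (b i)
        _ = _ := by simp
    · intro b hb
      obtain ⟨x, hx, rfl⟩ := mem_image.1 hb
      simpa using (mem_filter.1 hx).2
  calc _ ≤ ((2 * Y / p + 1) ^ m * _) * p := Nat.mul_le_mul_right _ h2
    _ = (2 * Y / p + 1) ^ m * (_ * p) := by ring
    _ ≤ (2 * Y / p + 1) ^ m * (r.totalDegree * p ^ m) := Nat.mul_le_mul_left _ h1
    _ = _ := by ring

theorem abs_mvEval_le {m : ℕ} (r : MvPolynomial (Fin m) ℤ) {Y : ℕ} (hY : 1 ≤ Y) {x : Fin m → ℤ}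
    (hx : ∀ i, |x i| ≤ Y) :
    |MvPolynomial.eval x r| ≤ (∑ d ∈ r.support, |r.coeff d|) * (Y : ℤ) ^ r.totalDegree := by
  rw [MvPolynomial.eval_eq', sum_mul]
  refine (abs_sum_le_sum_abs _ _).trans (sum_le_sum fun d hd => ?_)
  rw [abs_mul]
  refine mul_le_mul_of_nonneg_left ?_ (abs_nonneg _)
  rw [abs_prod]
  calc ∏ i, |x i ^ d i| ≤ ∏ i, (Y : ℤ) ^ d i := by
        refine prod_le_prod (fun i _ => abs_nonneg _) fun i _ => ?_
        rw [abs_pow]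
        exact pow_le_pow_left₀ (abs_nonneg _) (hx i) _
    _ = (Y : ℤ) ^ ∑ i, d i := prod_pow_eq_pow_sum _ _ _
    _ ≤ (Y : ℤ) ^ r.totalDegree := by
        refine pow_le_pow_right₀ (by exact_mod_cast hY) ?_
        have := MvPolynomial.le_totalDegree hd
        rwa [Finsupp.sum_fintype _ _ (fun _ => rfl)] at this

theorem card_filter_primeFactors_le {N Z k : ℕ} (hN : N ≠ 0) (hZ : N < Z ^ (k + 1)) :
    #{p ∈ N.primeFactors | Z ≤ p} ≤ k := by
  by_contra! h
  have h1 : Z ^ #{p ∈ N.primeFactors | Z ≤ p} ≤ N := by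
    calc _ ≤ ∏ p ∈ N.primeFactors with Z ≤ p, p :=
          pow_card_le_prod _ _ _ fun p hp => (mem_filter.1 hp).2
      _ ≤ ∏ p ∈ N.primeFactors, p :=
          prod_le_prod_of_subset_of_one_le' (filter_subset _ _)
            fun p hp _ => (Nat.prime_of_mem_primeFactors hp).one_lt.le
      _ ≤ N := Nat.le_of_dvd (Nat.pos_of_ne_zero hN) N.prod_primeFactors_dvd
  have hZ0 : 0 < Z := by
    rcases Nat.eq_zero_or_pos Z with rfl | h0
    · simp at hZ
    · exact h0
  exact absurd (hZ.trans_le ((Nat.pow_le_pow_right hZ0 h).trans h1)) (lt_irrefl _)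

theorem card_filter_product_le {α β : Type*} [DecidableEq α] [DecidableEq β] (A : Finset α)
    (B : Finset β)
    (P : α → Prop) (Q : α → β → Prop) [DecidablePred P] [∀ x, DecidablePred (Q x)] (k : ℕ)
    (h : ∀ x ∈ A, P x → #{y ∈ B | Q x y} ≤ k) :
    #{z ∈ A ×ˢ B | P z.1 ∧ Q z.1 z.2} ≤ #{x ∈ A | P x} * k := by
  refine le_trans (card_le_card (t := {x ∈ A | P x}.biUnion fun x =>
    {y ∈ B | Q x y}.image (Prod.mk x)) ?_) (card_biUnion_le_card_mul _ _ _ fun x hx =>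
      card_image_le.trans (h x (mem_filter.1 hx).1 (mem_filter.1 hx).2))
  rintro ⟨x, y⟩ hz
  simp only [mem_filter, mem_product, mem_biUnion, mem_image] at hz ⊢
  exact ⟨x, ⟨hz.1.1, hz.2.1⟩, y, ⟨hz.1.2, hz.2.2⟩, rfl⟩

theorem card_filter_dvd_eval_le {m : ℕ} {F : Polynomial (MvPolynomial (Fin m) ℤ)} {a : ℤ}
    (hF : F.leadingCoeff = MvPolynomial.C a) {p : ℕ} (hp : p.Prime) (hpa : ¬ (p : ℤ) ∣ a) (Y : ℕ)
    (x : Fin m → ℤ) :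
    #{y ∈ symIcc Y | (p : ℤ) ∣ (F.map (MvPolynomial.eval x)).eval y} ≤
      F.natDegree * (2 * Y / p + 1) := by
  have := Fact.mk hp
  set G := (F.map (MvPolynomial.eval x)).map (Int.castRingHom (ZMod p)) with hG
  have hG0 : G ≠ 0 := by
    intro h
    have h1 : G.coeff F.natDegree = 0 := by rw [h]; simp
    rw [hG, Polynomial.coeff_map, Polynomial.coeff_map, Polynomial.coeff_natDegree, hF] at h1
    rw [MvPolynomial.eval_C, eq_intCast] at h1
    exact hpa ((ZMod.intCast_zmod_eq_zero_iff_dvd _ _).1 h1)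
  have hdeg : G.natDegree ≤ F.natDegree :=
    Polynomial.natDegree_map_le.trans Polynomial.natDegree_map_le
  refine le_trans (card_le_card fun y hy => ?_)
    ((card_filter_eval_eq_zero_le Y hG0).trans (Nat.mul_le_mul_right _ hdeg))
  rw [mem_filter] at hy ⊢
  refine ⟨hy.1, ?_⟩
  rw [hG, Polynomial.eval_intCast_map]
  exact (ZMod.intCast_zmod_eq_zero_iff_dvd _ _).2 hy.2

theorem card_filter_dvd_mvEval_mul_le {m : ℕ} {r : MvPolynomial (Fin m) ℤ} {p : ℕ} (hp : p.Prime)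
    (hr : MvPolynomial.map (Int.castRingHom (ZMod p)) r ≠ 0) (Y : ℕ) :
    #{x ∈ Fintype.piFinset fun _ : Fin m => symIcc Y | (p : ℤ) ∣ MvPolynomial.eval x r} * p ≤
      r.totalDegree * p ^ m * (2 * Y / p + 1) ^ m := by
  have := Fact.mk hp
  refine le_trans (Nat.mul_le_mul_right _ (card_le_card fun y hy => ?_))
    ((card_filter_mvEval_cast_eq_zero_mul_le Y hr).trans (Nat.mul_le_mul_right _
      (Nat.mul_le_mul_right _ (Finset.sup_mono (MvPolynomial.support_map_subset _ _)))))
  rw [mem_filter] at hy ⊢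
  refine ⟨hy.1, ?_⟩
  have := MvPolynomial.map_eval (Int.castRingHom (ZMod p)) y r
  simp only [Function.comp_def, eq_intCast] at this
  rw [← this]
  exact (ZMod.intCast_zmod_eq_zero_iff_dvd _ _).2 hy.2

theorem map_intCast_ne_zero_of_lt {σ : Type*} {r : MvPolynomial σ ℤ} (hr : r ≠ 0) :
    ∃ P : ℕ, ∀ p : ℕ, P < p → MvPolynomial.map (Int.castRingHom (ZMod p)) r ≠ 0 := by
  obtain ⟨d, hd⟩ := MvPolynomial.ne_zero_iff.1 hr
  refine ⟨(r.coeff d).natAbs, fun p hp h => hd ?_⟩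
  have h1 := congrArg (MvPolynomial.coeff d) h
  rw [MvPolynomial.coeff_map, MvPolynomial.coeff_zero, eq_intCast,
    ZMod.intCast_zmod_eq_zero_iff_dvd] at h1
  exact Int.eq_zero_of_dvd_of_natAbs_lt_natAbs h1 (by simpa using hp)

theorem card_filter_dvd_dvd_le {m : ℕ} {F : Polynomial (MvPolynomial (Fin m) ℤ)} {a : ℤ}
    (hF : F.leadingCoeff = MvPolynomial.C a) {r : MvPolynomial (Fin m) ℤ} {p : ℕ} (hp : p.Prime)
    (hpa : ¬ (p : ℤ) ∣ a) (hr : MvPolynomial.map (Int.castRingHom (ZMod p)) r ≠ 0) {Y : ℕ}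
    (hpY : p ≤ Y) :
    (#{z ∈ (Fintype.piFinset fun _ : Fin m => symIcc Y) ×ˢ symIcc Y |
      (p : ℤ) ∣ MvPolynomial.eval z.1 r ∧ (p : ℤ) ∣ (F.map (MvPolynomial.eval z.1)).eval z.2} : ℝ) ≤
      r.totalDegree * F.natDegree * 3 ^ (m + 1) * (Y : ℝ) ^ (m + 1) * ((p : ℝ) ^ 2)⁻¹ := by
  have h1 := card_filter_product_le (Fintype.piFinset fun _ : Fin m => symIcc Y) (symIcc Y)
    (fun x => (p : ℤ) ∣ MvPolynomial.eval x r)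
    (fun x y => (p : ℤ) ∣ (F.map (MvPolynomial.eval x)).eval y) _
    (fun x _ _ => card_filter_dvd_eval_le hF hp hpa Y x)
  have h2 := card_filter_dvd_mvEval_mul_le hp hr Y
  have hp0 : (0 : ℝ) < p := by exact_mod_cast hp.pos
  have h3 : ((2 * Y / p + 1 : ℕ) : ℝ) ≤ 3 * Y / p := by
    have h4 : ((2 * Y / p : ℕ) : ℝ) ≤ (2 * Y : ℕ) / p := Nat.cast_div_le
    have h5 : (1 : ℝ) ≤ Y / p := by
      rw [one_le_div hp0]
      exact_mod_cast hpY
    push_cast at h4 ⊢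
    calc _ ≤ 2 * (Y : ℝ) / p + Y / p := add_le_add h4 h5
      _ = _ := by ring
  set u := #{z ∈ (Fintype.piFinset fun _ : Fin m => symIcc Y) ×ˢ symIcc Y |
      (p : ℤ) ∣ MvPolynomial.eval z.1 r ∧ (p : ℤ) ∣ (F.map (MvPolynomial.eval z.1)).eval z.2}
  set v := #{x ∈ Fintype.piFinset fun _ : Fin m => symIcc Y | (p : ℤ) ∣ MvPolynomial.eval x r}
  set w := 2 * Y / p + 1
  have h6 : u * p ≤ r.totalDegree * p ^ m * w ^ m * (F.natDegree * w) :=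
    calc u * p ≤ v * (F.natDegree * w) * p := Nat.mul_le_mul_right _ h1
      _ = v * p * (F.natDegree * w) := by ring
      _ ≤ _ := Nat.mul_le_mul_right _ h2
  have h7 : (u : ℝ) * p ≤ r.totalDegree * F.natDegree * p ^ m * (3 * Y / p) ^ (m + 1) := by
    calc (u : ℝ) * p ≤ r.totalDegree * p ^ m * w ^ m * (F.natDegree * w) := by exact_mod_cast h6
      _ = r.totalDegree * F.natDegree * p ^ m * w ^ (m + 1) := by ring
      _ ≤ _ := by gcongr
  refine le_of_mul_le_mul_right (h7.trans (le_of_eq ?_)) hp0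
  rw [div_pow, mul_pow]
  field_simp
  ring

theorem sum_primes_inv_sq_le {M Y : ℕ} (hM : 0 < M) :
    ∑ p ∈ (Ioc M Y).filter Nat.Prime, ((p : ℝ) ^ 2)⁻¹ ≤ 1 / M := by
  refine (sum_le_sum_of_subset_of_nonneg (filter_subset _ _) fun _ _ _ => by positivity).trans ?_
  rcases le_total M Y with h | h
  · refine (sum_Ioc_inv_sq_le_sub hM.ne' h).trans ?_
    rw [one_div]
    exact sub_le_self _ (by positivity)
  · rw [Ioc_eq_empty_of_le h]; simp

open scoped Classical in
theorem card_filter_exists_dvd_le_of_lt {m : ℕ} {F : Polynomial (MvPolynomial (Fin m) ℤ)} {a : ℤ}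
    (ha : a ≠ 0) (hF : F.leadingCoeff = MvPolynomial.C a) {r : MvPolynomial (Fin m) ℤ}
    {M Y : ℕ} (hY : 1 ≤ Y) (haM : a.natAbs ≤ M)
    (hrM : (∑ d ∈ r.support, |r.coeff d|).toNat ≤ M) {x : Fin m → ℤ} (hx : ∀ i, |x i| ≤ Y)
    (hr : MvPolynomial.eval x r ≠ 0) :
    #{y ∈ symIcc Y | ∃ p : ℕ, p.Prime ∧ max M Y < p ∧ (p : ℤ) ∣ MvPolynomial.eval x r ∧
      (p : ℤ) ∣ (F.map (MvPolynomial.eval x)).eval y} ≤ r.totalDegree * (F.natDegree * 2) := by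
  set N := (MvPolynomial.eval x r).natAbs with hN
  have hN0 : N ≠ 0 := Int.natAbs_ne_zero.2 hr
  have hNZ : N < (max M Y + 1) ^ (r.totalDegree + 1) := by
    have h1 := abs_mvEval_le r hY hx
    have h0 : 0 ≤ ∑ d ∈ r.support, |r.coeff d| := sum_nonneg fun _ _ => abs_nonneg _
    rw [← Int.toNat_of_nonneg h0, Int.abs_eq_natAbs, ← hN] at h1
    have h2 : N ≤ (∑ d ∈ r.support, |r.coeff d|).toNat * Y ^ r.totalDegree := by exact_mod_cast h1
    calc N ≤ max M Y * (max M Y + 1) ^ r.totalDegree := h2.trans (Nat.mul_le_mul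
            (hrM.trans (le_max_left _ _))
            (Nat.pow_le_pow_left ((le_max_right _ _).trans (Nat.le_succ _)) _))
      _ < (max M Y + 1) * (max M Y + 1) ^ r.totalDegree :=
          Nat.mul_lt_mul_of_pos_right (Nat.lt_succ_self _) (by positivity)
      _ = _ := by ring
  refine le_trans (card_le_card (t := {p ∈ N.primeFactors | max M Y + 1 ≤ p}.biUnion fun p =>
    {y ∈ symIcc Y | (p : ℤ) ∣ (F.map (MvPolynomial.eval x)).eval y}) fun y hy => ?_)
    ((card_biUnion_le_card_mul _ _ (F.natDegree * 2) fun p hp => ?_).trans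
      (Nat.mul_le_mul_right _ (card_filter_primeFactors_le hN0 hNZ)))
  · simp only [mem_filter, mem_biUnion] at hy ⊢
    obtain ⟨hyY, p, hp, hMp, hpr, hpF⟩ := hy
    exact ⟨p, ⟨Nat.mem_primeFactors.2 ⟨hp, Int.natCast_dvd.1 hpr, hN0⟩, hMp⟩, hyY, hpF⟩
  · rw [mem_filter] at hp
    have hpp := Nat.prime_of_mem_primeFactors hp.1
    have hpM : M < p := lt_of_le_of_lt (le_max_left _ _) hp.2
    have hpY : Y < p := lt_of_le_of_lt (le_max_right _ _) hp.2
    refine (card_filter_dvd_eval_le hF hpp (fun h => ha ?_) Y x).trans (Nat.mul_le_mul_left _ ?_)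
    · exact Int.eq_zero_of_dvd_of_natAbs_lt_natAbs h (by simpa using haM.trans_lt hpM)
    · have : 2 * Y / p < 2 := by
        rw [Nat.div_lt_iff_lt_mul hpp.pos]
        omega
      omega

theorem exists_card_filter_exists_dvd_le {m : ℕ} (F : Polynomial (MvPolynomial (Fin m) ℤ)) {a : ℤ}
    (ha : a ≠ 0) (hF : F.leadingCoeff = MvPolynomial.C a) {r : MvPolynomial (Fin m) ℤ}
    (hr : r ≠ 0) :
    ∃ C : ℝ, 0 ≤ C ∧ ∃ P : ℕ, ∀ M Y : ℕ, P ≤ M → 1 ≤ Y →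
      (Set.ncard {z : (Fin m → ℤ) × ℤ | (∀ i, |z.1 i| ≤ Y) ∧ |z.2| ≤ Y ∧
        ∃ p : ℕ, p.Prime ∧ M < p ∧ (p : ℤ) ∣ MvPolynomial.eval z.1 r ∧
        (p : ℤ) ∣ (F.map (MvPolynomial.eval z.1)).eval z.2} : ℝ) ≤
        C * ((Y : ℝ) ^ (m + 1) / M + (Y : ℝ) ^ m) := by
  classical
  obtain ⟨P, hP⟩ := map_intCast_ne_zero_of_lt hr
  set D := r.totalDegree
  set d := F.natDegree
  refine ⟨D * d * 3 ^ (m + 1) + D * 3 ^ m + D * (d * 2) * 3 ^ m, by positivity,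
    max (max P 1) (max a.natAbs (∑ d ∈ r.support, |r.coeff d|).toNat), fun M Y hM hY => ?_⟩
  have hPM : P ≤ M := (le_max_left _ _).trans ((le_max_left _ _).trans hM)
  have hM1 : 1 ≤ M := (le_max_right _ _).trans ((le_max_left _ _).trans hM)
  have haM : a.natAbs ≤ M := (le_max_left _ _).trans ((le_max_right _ _).trans hM)
  have hrM := (le_max_right _ _).trans ((le_max_right _ _).trans hM)
  set A := Fintype.piFinset fun _ : Fin m => symIcc Y with hA
  have hAx : ∀ x, x ∈ A ↔ ∀ i, |x i| ≤ Y := fun x => by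
    simp [hA, Fintype.mem_piFinset, abs_le]
  have hS : #(symIcc Y) = 2 * Y + 1 := by
    rw [Int.card_Icc]; omega
  have hAc : #A = (2 * Y + 1) ^ m := by
    rw [hA, Fintype.card_piFinset]; simp only [hS]; simp
  have hpow : ((2 * Y + 1 : ℕ) : ℝ) ^ m ≤ 3 ^ m * (Y : ℝ) ^ m := by
    rw [← mul_pow]
    refine pow_le_pow_left₀ (by positivity) ?_ _
    have : (1 : ℝ) ≤ Y := by exact_mod_cast hY
    push_cast
    linarith
  set U₁ := ((Ioc M Y).filter Nat.Prime).biUnion fun p => {z ∈ A ×ˢ symIcc Y |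
    (p : ℤ) ∣ MvPolynomial.eval z.1 r ∧ (p : ℤ) ∣ (F.map (MvPolynomial.eval z.1)).eval z.2}
    with hU₁
  set U₂ := {z ∈ A ×ˢ symIcc Y | MvPolynomial.eval z.1 r = 0 ∧ True} with hU₂
  set U₃ := {z ∈ A ×ˢ symIcc Y | MvPolynomial.eval z.1 r ≠ 0 ∧ ∃ p : ℕ, p.Prime ∧ max M Y < p ∧
    (p : ℤ) ∣ MvPolynomial.eval z.1 r ∧ (p : ℤ) ∣ (F.map (MvPolynomial.eval z.1)).eval z.2} with hU₃
  have hsub : {z : (Fin m → ℤ) × ℤ | (∀ i, |z.1 i| ≤ Y) ∧ |z.2| ≤ Y ∧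
        ∃ p : ℕ, p.Prime ∧ M < p ∧ (p : ℤ) ∣ MvPolynomial.eval z.1 r ∧
        (p : ℤ) ∣ (F.map (MvPolynomial.eval z.1)).eval z.2} ⊆ (U₁ ∪ U₂ ∪ U₃ : Finset _) := by
    rintro ⟨x, y⟩ ⟨hx, hy, p, hp, hMp, hpr, hpF⟩
    have hxy : (x, y) ∈ A ×ˢ symIcc Y := by
      rw [mem_product, hAx]
      exact ⟨hx, mem_Icc.2 (abs_le.1 hy)⟩
    rw [mem_coe, mem_union, mem_union]
    by_cases h0 : MvPolynomial.eval x r = 0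
    · exact Or.inl (Or.inr (mem_filter.2 ⟨hxy, h0, trivial⟩))
    by_cases hpY : p ≤ Y
    · exact Or.inl (Or.inl (mem_biUnion.2 ⟨p, mem_filter.2 ⟨mem_Ioc.2 ⟨hMp, hpY⟩, hp⟩,
        mem_filter.2 ⟨hxy, hpr, hpF⟩⟩))
    · exact Or.inr (mem_filter.2 ⟨hxy, h0, p, hp, max_lt hMp (not_le.1 hpY), hpr, hpF⟩)
  have h1 : (#U₁ : ℝ) ≤ D * d * 3 ^ (m + 1) * ((Y : ℝ) ^ (m + 1) / M) := by
    calc (#U₁ : ℝ) ≤ ∑ p ∈ (Ioc M Y).filter Nat.Prime, (#{z ∈ A ×ˢ symIcc Y |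
          (p : ℤ) ∣ MvPolynomial.eval z.1 r ∧
          (p : ℤ) ∣ (F.map (MvPolynomial.eval z.1)).eval z.2} : ℝ) := by
          exact_mod_cast card_biUnion_le
      _ ≤ ∑ p ∈ (Ioc M Y).filter Nat.Prime,
          D * d * 3 ^ (m + 1) * (Y : ℝ) ^ (m + 1) * ((p : ℝ) ^ 2)⁻¹ := by
          refine sum_le_sum fun p hp => ?_
          rw [mem_filter, mem_Ioc] at hp
          refine card_filter_dvd_dvd_le hF hp.2 (fun h => ha ?_) (hP p (hPM.trans_lt hp.1.1)) hp.1.2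
          exact Int.eq_zero_of_dvd_of_natAbs_lt_natAbs h (by simpa using haM.trans_lt hp.1.1)
      _ = D * d * 3 ^ (m + 1) * (Y : ℝ) ^ (m + 1) *
          ∑ p ∈ (Ioc M Y).filter Nat.Prime, ((p : ℝ) ^ 2)⁻¹ := by rw [mul_sum]
      _ ≤ D * d * 3 ^ (m + 1) * (Y : ℝ) ^ (m + 1) * (1 / M) := by
          gcongr
          exact sum_primes_inv_sq_le hM1
      _ = _ := by ring
  have h2 : (#U₂ : ℝ) ≤ D * 3 ^ m * (Y : ℝ) ^ m := by
    have h := (card_filter_product_le A (symIcc Y) (fun x => MvPolynomial.eval x r = 0)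
      (fun _ _ => True) #(symIcc Y) (fun _ _ _ => card_filter_le _ _)).trans
        (card_filter_mvEval_eq_zero_mul_le hr (symIcc Y))
    rw [hS] at h
    calc (#U₂ : ℝ) ≤ D * ((2 * Y + 1 : ℕ) : ℝ) ^ m := by exact_mod_cast h
      _ ≤ D * (3 ^ m * (Y : ℝ) ^ m) := by gcongr
      _ = _ := by ring
  have h3 : (#U₃ : ℝ) ≤ D * (d * 2) * 3 ^ m * (Y : ℝ) ^ m := by
    have h : #U₃ ≤ (2 * Y + 1) ^ m * (D * (d * 2)) := by
      refine (card_filter_product_le A (symIcc Y) (fun x => MvPolynomial.eval x r ≠ 0)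
        (fun x y => ∃ p : ℕ, p.Prime ∧ max M Y < p ∧ (p : ℤ) ∣ MvPolynomial.eval x r ∧
          (p : ℤ) ∣ (F.map (MvPolynomial.eval x)).eval y) _ (fun x hx h0 =>
        card_filter_exists_dvd_le_of_lt ha hF hY haM hrM ((hAx x).1 hx) h0)).trans ?_
      rw [← hAc]
      exact Nat.mul_le_mul_right _ (card_filter_le _ _)
    calc (#U₃ : ℝ) ≤ ((2 * Y + 1 : ℕ) : ℝ) ^ m * (D * (d * 2)) := by exact_mod_cast h
      _ ≤ (3 ^ m * (Y : ℝ) ^ m) * (D * (d * 2)) := by gcongr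
      _ = _ := by ring
  have hcard : (Set.ncard {z : (Fin m → ℤ) × ℤ | (∀ i, |z.1 i| ≤ Y) ∧ |z.2| ≤ Y ∧
        ∃ p : ℕ, p.Prime ∧ M < p ∧ (p : ℤ) ∣ MvPolynomial.eval z.1 r ∧
        (p : ℤ) ∣ (F.map (MvPolynomial.eval z.1)).eval z.2} : ℝ) ≤ #U₁ + #U₂ + #U₃ := by
    have h := Set.ncard_le_ncard hsub (finite_toSet _)
    rw [Set.ncard_coe_finset] at h
    exact_mod_cast h.trans ((card_union_le _ _).trans (Nat.add_le_add_right (card_union_le _ _) _))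
  have hq : 0 ≤ (Y : ℝ) ^ (m + 1) / M := by positivity
  have hq' : 0 ≤ (Y : ℝ) ^ m := by positivity
  have e1 : 0 ≤ (D * d * 3 ^ (m + 1) : ℝ) * (Y : ℝ) ^ m := by positivity
  have e2 : 0 ≤ (D * 3 ^ m + D * (d * 2) * 3 ^ m : ℝ) * ((Y : ℝ) ^ (m + 1) / M) := by positivity
  nlinarith [hcard, h1, h2, h3, e1, e2]

theorem natDegree_prod_pow_le_and_coeff {R ι : Type*} [CommRing R] (s : Finset ι)
    (L : ι → Polynomial R) (hL : ∀ i, (L i).natDegree ≤ 1) (d : ι → ℕ) :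
    (∏ i ∈ s, L i ^ d i).natDegree ≤ ∑ i ∈ s, d i ∧
      (∏ i ∈ s, L i ^ d i).coeff (∑ i ∈ s, d i) = ∏ i ∈ s, (L i).coeff 1 ^ d i := by
  classical
  induction s using Finset.induction_on with
  | empty => simp
  | insert i s his ih =>
    rw [prod_insert his, sum_insert his, prod_insert his]
    have h1 : (L i ^ d i).natDegree ≤ d i := by
      simpa using Polynomial.natDegree_pow_le_of_le (d i) (hL i)
    have h2 : (L i ^ d i).coeff (d i) = (L i).coeff 1 ^ d i := by
      simpa using Polynomial.coeff_pow_of_natDegree_le (m := d i) (hL i)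
    exact ⟨Polynomial.natDegree_mul_le_of_le h1 ih.1, by
      rw [Polynomial.coeff_mul_add_eq_of_natDegree_le h1 ih.1, h2, ih.2]⟩

/-- The linear change of variables `xᵢ₊₁ ↦ xᵢ₊₁ + tᵢ x₀`. -/
noncomputable def shearHom {m : ℕ} (t : Fin m → ℤ) :
    MvPolynomial (Fin (m + 1)) ℤ →ₐ[ℤ] MvPolynomial (Fin (m + 1)) ℤ :=
  MvPolynomial.aeval (Fin.cons (MvPolynomial.X 0)
    fun i => MvPolynomial.X i.succ + MvPolynomial.C (t i) * MvPolynomial.X 0)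

theorem shearHom_comp_neg {m : ℕ} (t : Fin m → ℤ) :
    (shearHom t).comp (shearHom (-t)) = AlgHom.id ℤ _ := by
  refine MvPolynomial.algHom_ext fun i => ?_
  refine Fin.cases ?_ (fun i => ?_) i <;> simp [shearHom]

/-- The shear `shearHom t` followed by viewing the result as a polynomial in the first variable. -/
noncomputable def shearEquiv {m : ℕ} (t : Fin m → ℤ) :
    MvPolynomial (Fin (m + 1)) ℤ ≃ₐ[ℤ] Polynomial (MvPolynomial (Fin m) ℤ) :=
  (AlgEquiv.ofAlgHom (shearHom t) (shearHom (-t)) (shearHom_comp_neg t)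
    (by simpa using shearHom_comp_neg (-t))).trans (MvPolynomial.finSuccEquiv ℤ m)

theorem shearEquiv_X {m : ℕ} (t : Fin m → ℤ) (i : Fin (m + 1)) :
    shearEquiv t (MvPolynomial.X i) = (Fin.cons Polynomial.X fun i : Fin m =>
      Polynomial.C (MvPolynomial.X i) + Polynomial.C (MvPolynomial.C (t i)) * Polynomial.X :
      Fin (m + 1) → Polynomial (MvPolynomial (Fin m) ℤ)) i := by
  change MvPolynomial.finSuccEquiv ℤ m (shearHom t (MvPolynomial.X i)) = _
  rw [shearHom, MvPolynomial.aeval_X]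
  refine Fin.cases ?_ (fun i => ?_) i
  · rw [Fin.cons_zero, Fin.cons_zero, MvPolynomial.finSuccEquiv_X_zero]
  · rw [Fin.cons_succ, Fin.cons_succ, map_add, map_mul, MvPolynomial.finSuccEquiv_X_zero,
      MvPolynomial.finSuccEquiv_X_succ]
    simp

theorem eval_map_shearEquiv {m : ℕ} (t : Fin m → ℤ) (f : MvPolynomial (Fin (m + 1)) ℤ)
    (x : Fin m → ℤ) (y : ℤ) :
    ((shearEquiv t f).map (MvPolynomial.eval x)).eval y =
      MvPolynomial.eval (Fin.cons y fun i => x i + t i * y : Fin (m + 1) → ℤ) f := by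
  have h : ((Polynomial.evalRingHom y).comp ((Polynomial.mapRingHom (MvPolynomial.eval x)).comp
      ((shearEquiv t : _ ≃ₐ[ℤ] _) : _ →+* Polynomial (MvPolynomial (Fin m) ℤ)))) =
      MvPolynomial.eval (Fin.cons y fun i => x i + t i * y : Fin (m + 1) → ℤ) := by
    refine MvPolynomial.ringHom_ext (fun r => by simp) fun i => ?_
    refine Fin.cases ?_ (fun i => ?_) i <;> simp [shearEquiv_X]
  exact congrArg (fun φ : MvPolynomial (Fin (m + 1)) ℤ →+* ℤ => φ f) h

theorem natDegree_shearEquiv_le_and_coeff {m : ℕ} (t : Fin m → ℤ)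
    (f : MvPolynomial (Fin (m + 1)) ℤ) :
    (shearEquiv t f).natDegree ≤ f.totalDegree ∧
      (shearEquiv t f).coeff f.totalDegree = MvPolynomial.C (MvPolynomial.eval t
        (∑ d ∈ f.support with ∑ i, d i = f.totalDegree,
          MvPolynomial.monomial d.tail (f.coeff d))) := by
  set L : Fin (m + 1) → Polynomial (MvPolynomial (Fin m) ℤ) := Fin.cons Polynomial.X
    fun i : Fin m => Polynomial.C (MvPolynomial.X i) +
      Polynomial.C (MvPolynomial.C (t i)) * Polynomial.X with hLdef
  have hL : ∀ i, (L i).natDegree ≤ 1 := by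
    refine Fin.cases ?_ fun i => ?_
    · simp [hLdef]
    · simp only [hLdef, Fin.cons_succ]
      compute_degree
  have hf : shearEquiv t f = ∑ d ∈ f.support,
      Polynomial.C (MvPolynomial.C (f.coeff d)) * ∏ i, L i ^ d i := by
    conv_lhs => rw [f.as_sum]
    rw [map_sum]
    refine sum_congr rfl fun d _ => ?_
    rw [MvPolynomial.monomial_eq, map_mul, Finsupp.prod_fintype _ _ (by simp), map_prod]
    congr 1
    · simp
    · simp only [map_pow, shearEquiv_X, hLdef]
  have hle : ∀ d ∈ f.support, ∑ i, d i ≤ f.totalDegree := fun d hd => by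
    have := MvPolynomial.le_totalDegree hd
    rwa [Finsupp.sum_fintype _ _ (fun _ => rfl)] at this
  have hdeg : ∀ d ∈ f.support, (Polynomial.C (MvPolynomial.C (f.coeff d)) *
      ∏ i, L i ^ d i).natDegree ≤ ∑ i, d i := fun d _ =>
    (Polynomial.natDegree_C_mul_le _ _).trans (natDegree_prod_pow_le_and_coeff univ L hL d).1
  refine ⟨?_, ?_⟩
  · rw [hf]
    exact Polynomial.natDegree_sum_le_of_forall_le _ _ fun d hd => (hdeg d hd).trans (hle d hd)
  · rw [hf, Polynomial.finsetSum_coeff, sum_filter, map_sum, map_sum]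
    refine sum_congr rfl fun d hd => ?_
    split_ifs with h
    · rw [← h, Polynomial.coeff_C_mul, (natDegree_prod_pow_le_and_coeff univ L hL d).2,
        MvPolynomial.eval_monomial, map_mul, Finsupp.prod_fintype _ _ (by simp), map_prod,
        Fin.prod_univ_succ]
      simp [hLdef, Finsupp.tail_apply]
    · rw [Polynomial.coeff_eq_zero_of_natDegree_lt
        ((hdeg d hd).trans_lt (lt_of_le_of_ne (hle d hd) h))]
      simp

theorem exists_leadingCoeff_shearEquiv {m : ℕ} {f : MvPolynomial (Fin (m + 1)) ℤ} (hf : f ≠ 0) :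
    ∃ t : Fin m → ℤ, ∃ a : ℤ, a ≠ 0 ∧ (shearEquiv t f).leadingCoeff = MvPolynomial.C a := by
  classical
  set h := ∑ d ∈ f.support with ∑ i, d i = f.totalDegree,
    MvPolynomial.monomial d.tail (f.coeff d) with hh
  have hne : h ≠ 0 := by
    obtain ⟨d, hd, hdd⟩ := exists_mem_eq_sup f.support (MvPolynomial.support_nonempty.2 hf)
      (fun s => s.sum fun _ e => e)
    rw [Finsupp.sum_fintype _ _ (fun _ => rfl)] at hdd
    intro h0
    have h1 : h.coeff d.tail = f.coeff d := by
      rw [hh, MvPolynomial.coeff_sum, sum_eq_single d]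
      · simp
      · intro e he hed
        rw [MvPolynomial.coeff_monomial, if_neg]
        intro het
        refine hed ?_
        have h2 : ∑ i, e i = ∑ i, d i := (mem_filter.1 he).2.trans hdd
        have h3 : ∀ i : Fin m, e i.succ = d i.succ := fun i => DFunLike.congr_fun het i
        rw [Fin.sum_univ_succ, Fin.sum_univ_succ] at h2
        simp only [h3] at h2
        ext i
        refine Fin.cases ?_ h3 i
        omega
      · intro hdn
        exact absurd (mem_filter.2 ⟨hd, hdd.symm⟩) hdn
    rw [h0, MvPolynomial.coeff_zero] at h1
    exact MvPolynomial.mem_support_iff.1 hd h1.symm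
  obtain ⟨t, ht⟩ : ∃ t, MvPolynomial.eval t h ≠ 0 := by
    by_contra! hall
    exact hne (MvPolynomial.funext fun t => by rw [hall t, map_zero])
  refine ⟨t, _, ht, ?_⟩
  obtain ⟨h1, h2⟩ := natDegree_shearEquiv_le_and_coeff t f
  have h3 : (shearEquiv t f).natDegree = f.totalDegree := by
    refine le_antisymm h1 (Polynomial.le_natDegree_of_ne_zero ?_)
    rw [h2]
    exact fun h => ht (MvPolynomial.C_eq_zero.1 h)
  rw [← Polynomial.coeff_natDegree, h3, h2]

theorem exists_C_eq_mul_add_mul {R : Type*} [CommRing R] [IsDomain R]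
    [UniqueFactorizationMonoid R] {F G : Polynomial R} (hF : F ≠ 0)
    (h : ∀ q : Polynomial R, q.IsPrimitive → q ∣ F → q ∣ G → IsUnit q) :
    ∃ r : R, r ≠ 0 ∧ ∃ A B : Polynomial R, F * A + G * B = Polynomial.C r := by
  classical
  by_cases hF0 : F.natDegree = 0
  · obtain ⟨r, rfl⟩ := Polynomial.natDegree_eq_zero.1 hF0
    exact ⟨r, fun h => hF (by rw [h, map_zero]), 1, 0, by simp⟩
  obtain ⟨A, B, -, -, hAB⟩ := Polynomial.exists_mul_add_mul_eq_C_resultant F G le_rfl le_rfl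
    (Or.inl hF0)
  refine ⟨_, fun h0 => ?_, A, B, hAB⟩
  let K := FractionRing R
  have hinj : Function.Injective (algebraMap R K) := IsFractionRing.injective R K
  have hco : IsCoprime (F.map (algebraMap R K)) (G.map (algebraMap R K)) := by
    refine isCoprime_of_dvd _ _ (fun h1 => hF ?_) fun z hz hz0 hzF hzG => hz ?_
    · exact (Polynomial.map_eq_zero_iff hinj).1 h1.1
    let _ : NormalizedGCDMonoid R := Classical.arbitrary _
    refine Polynomial.isUnit_or_eq_zero_of_isUnit_integerNormalization_primPart (R := R) hz0 ?_
    set w := IsLocalization.integerNormalization (nonZeroDivisors R) z with hw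
    obtain ⟨b, hb, hbz⟩ := IsLocalization.integerNormalization_spec (nonZeroDivisors R) z
    have hbK : IsUnit (Polynomial.C (algebraMap R K b)) :=
      Polynomial.isUnit_C.2 (isUnit_iff_ne_zero.2 (IsFractionRing.to_map_ne_zero_of_mem_nonZeroDivisors hb))
    have hdvd : w.primPart.map (algebraMap R K) ∣ z := by
      have h1 : w.primPart.map (algebraMap R K) ∣ w.map (algebraMap R K) :=
        Polynomial.map_dvd _ w.primPart_dvd
      rw [hw, hbz, Algebra.smul_def, Polynomial.algebraMap_apply] at h1
      exact (hbK.dvd_mul_left).1 h1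
    exact h _ w.isPrimitive_primPart
      (w.isPrimitive_primPart.dvd_of_fraction_map_dvd_fraction_map (K := K) (hdvd.trans hzF))
      (w.isPrimitive_primPart.dvd_of_fraction_map_dvd_fraction_map (K := K) (hdvd.trans hzG))
  refine Polynomial.resultant_ne_zero _ _ hco ?_
  rw [Polynomial.natDegree_map_eq_of_injective hinj, Polynomial.natDegree_map_eq_of_injective hinj,
    Polynomial.resultant_map_map, h0, map_zero]

theorem exists_ncard_dvd_dvd_le_of_ne_zero {n : ℕ} {g₁ g₂ : MvPolynomial (Fin (n + 1)) ℤ}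
    (hcop : ∀ q : MvPolynomial (Fin (n + 1)) ℤ, q ∣ g₁ → q ∣ g₂ → q.totalDegree = 0)
    (hg : g₁ ≠ 0) :
    ∃ C : ℝ, 0 ≤ C ∧ ∃ P : ℕ, ∀ M Y : ℕ, P ≤ M → 1 ≤ Y →
      (Set.ncard {c : Fin (n + 1) → ℤ | (∀ i, |c i| ≤ Y) ∧ ∃ p : ℕ, p.Prime ∧ M < p ∧
        (p : ℤ) ∣ MvPolynomial.eval c g₁ ∧ (p : ℤ) ∣ MvPolynomial.eval c g₂} : ℝ) ≤
        C * ((Y : ℝ) ^ (n + 1) / M + (Y : ℝ) ^ n) := by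
  obtain ⟨t, a, ha, hlead⟩ := exists_leadingCoeff_shearEquiv hg
  obtain ⟨r, hr, A, B, hAB⟩ := exists_C_eq_mul_add_mul (F := shearEquiv t g₁)
    (G := shearEquiv t g₂) (by simpa using hg) (by
      intro q hq h1 h2
      have h3 := hcop ((shearEquiv t).symm q)
        (by simpa using map_dvd (shearEquiv t).symm h1)
        (by simpa using map_dvd (shearEquiv t).symm h2)
      rw [MvPolynomial.totalDegree_eq_zero_iff_eq_C, AlgEquiv.symm_apply_eq] at h3
      set e := MvPolynomial.coeff 0 ((shearEquiv t).symm q)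
      have h4 := (shearEquiv t).commutes e
      rw [MvPolynomial.algebraMap_eq] at h4
      rw [h4, IsScalarTower.algebraMap_apply ℤ (MvPolynomial (Fin n) ℤ),
        Polynomial.algebraMap_apply, Algebra.algebraMap_self, RingHom.id_apply] at h3
      rw [h3]
      exact Polynomial.isUnit_C.2 (hq _ (by rw [h3])))
  obtain ⟨C, hC, P, hP⟩ := exists_card_filter_exists_dvd_le (shearEquiv t g₁) ha hlead hr
  set K : ℕ := 1 + ∑ i, (t i).natAbs with hK
  have hK1 : 1 ≤ K := by omega
  refine ⟨C * (K : ℝ) ^ (n + 1), by positivity, P, fun M Y hM hY => ?_⟩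
  have hKY := hP M (K * Y) hM (Nat.mul_pos hK1 hY)
  have hle := Set.ncard_le_ncard_of_injOn
    (s := {c : Fin (n + 1) → ℤ | (∀ i, |c i| ≤ Y) ∧ ∃ p : ℕ, p.Prime ∧ M < p ∧
        (p : ℤ) ∣ MvPolynomial.eval c g₁ ∧ (p : ℤ) ∣ MvPolynomial.eval c g₂})
    (t := {z : (Fin n → ℤ) × ℤ | (∀ i, |z.1 i| ≤ (K * Y : ℕ)) ∧ |z.2| ≤ (K * Y : ℕ) ∧
        ∃ p : ℕ, p.Prime ∧ M < p ∧ (p : ℤ) ∣ MvPolynomial.eval z.1 r ∧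
        (p : ℤ) ∣ ((shearEquiv t g₁).map (MvPolynomial.eval z.1)).eval z.2})
    (fun c => (fun i => c i.succ - t i * c 0, c 0)) ?_ ?_ ?_
  · refine (Nat.cast_le.2 hle).trans (hKY.trans ?_)
    have hK1' : (1 : ℝ) ≤ K := by exact_mod_cast hK1
    have h1 : (K : ℝ) ^ n * (Y : ℝ) ^ n ≤ (K : ℝ) ^ (n + 1) * (Y : ℝ) ^ n := by
      gcongr
      · omega
    calc C * (((K * Y : ℕ) : ℝ) ^ (n + 1) / M + ((K * Y : ℕ) : ℝ) ^ n)
        = C * ((K : ℝ) ^ (n + 1) * ((Y : ℝ) ^ (n + 1) / M) + (K : ℝ) ^ n * (Y : ℝ) ^ n) := by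
          push_cast; ring
      _ ≤ C * ((K : ℝ) ^ (n + 1) * ((Y : ℝ) ^ (n + 1) / M) + (K : ℝ) ^ (n + 1) * (Y : ℝ) ^ n) := by
          gcongr
      _ = _ := by ring
  · rintro c ⟨hc, p, hp, hMp, h1, h2⟩
    have hcons : (Fin.cons (c 0) fun i => c i.succ - t i * c 0 + t i * c 0 : Fin (n + 1) → ℤ) = c := by
      ext i
      refine Fin.cases ?_ (fun i => ?_) i <;> simp
    have hev : ∀ g, ((shearEquiv t g).map (MvPolynomial.eval fun i => c i.succ - t i * c 0)).eval
        (c 0) = MvPolynomial.eval c g := fun g => by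
      rw [eval_map_shearEquiv, hcons]
    have hY0 : (0 : ℤ) ≤ Y := by positivity
    refine ⟨fun i => ?_, ?_, p, hp, hMp, ?_, ?_⟩
    · have hti : (t i).natAbs ≤ ∑ i, (t i).natAbs :=
        single_le_sum (f := fun i => (t i).natAbs) (fun _ _ => Nat.zero_le _) (mem_univ i)
      have hti' : |t i| + 1 ≤ (K : ℤ) := by
        rw [Int.abs_eq_natAbs]; omega
      calc |c i.succ - t i * c 0| ≤ |c i.succ| + |t i * c 0| := abs_sub _ _
        _ ≤ Y + |t i| * Y := by
            rw [abs_mul]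
            exact add_le_add (hc _) (mul_le_mul_of_nonneg_left (hc _) (abs_nonneg _))
        _ = (|t i| + 1) * Y := by ring
        _ ≤ K * Y := mul_le_mul_of_nonneg_right hti' hY0
        _ = _ := by push_cast; ring
    · refine (hc 0).trans ?_
      exact_mod_cast Nat.le_mul_of_pos_left Y hK1
    · have h3 := congrArg (fun q : Polynomial (MvPolynomial (Fin n) ℤ) =>
        (q.map (MvPolynomial.eval fun i => c i.succ - t i * c 0)).eval (c 0)) hAB
      simp only [Polynomial.map_add, Polynomial.map_mul, Polynomial.eval_add, Polynomial.eval_mul,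
        hev, Polynomial.map_C, Polynomial.eval_C] at h3
      rw [← h3]
      exact dvd_add (h1.mul_right _) (h2.mul_right _)
    · rw [hev]; exact h1
  · intro c _ c' _ h
    rw [Prod.mk.injEq] at h
    ext i
    refine Fin.cases h.2 (fun i => ?_) i
    have h1 := congrFun h.1 i
    simp only [h.2] at h1
    linarith
  · refine ((Fintype.piFinset fun _ : Fin n => symIcc (K * Y)) ×ˢ symIcc (K * Y)).finite_toSet.subset
      ?_
    rintro ⟨x, y⟩ ⟨hx, hy, -⟩
    rw [mem_coe, mem_product, Fintype.mem_piFinset]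
    exact ⟨fun i => mem_Icc.2 (abs_le.1 (hx i)), mem_Icc.2 (abs_le.1 hy)⟩

theorem exists_ncard_dvd_dvd_le {n : ℕ} {g₁ g₂ : MvPolynomial (Fin (n + 1)) ℤ}
    (hcop : ∀ q : MvPolynomial (Fin (n + 1)) ℤ, q ∣ g₁ → q ∣ g₂ → q.totalDegree = 0) :
    ∃ C : ℝ, 0 ≤ C ∧ ∃ P : ℕ, ∀ M Y : ℕ, P ≤ M → 1 ≤ Y →
      (Set.ncard {c : Fin (n + 1) → ℤ | (∀ i, |c i| ≤ Y) ∧ ∃ p : ℕ, p.Prime ∧ M < p ∧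
        (p : ℤ) ∣ MvPolynomial.eval c g₁ ∧ (p : ℤ) ∣ MvPolynomial.eval c g₂} : ℝ) ≤
        C * ((Y : ℝ) ^ (n + 1) / M + (Y : ℝ) ^ n) := by
  by_cases h1 : g₁ = 0
  · by_cases h2 : g₂ = 0
    · have h := hcop (MvPolynomial.X 0) (h1 ▸ dvd_zero _) (h2 ▸ dvd_zero _)
      rw [MvPolynomial.totalDegree_X] at h
      exact absurd h one_ne_zero
    · obtain ⟨C, hC, P, hP⟩ := exists_ncard_dvd_dvd_le_of_ne_zero (g₁ := g₂) (g₂ := g₁)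
        (fun q hq hq' => hcop q hq' hq) h2
      refine ⟨C, hC, P, fun M Y hM hY => ?_⟩
      simpa only [and_comm (a := (_ : ℤ) ∣ MvPolynomial.eval _ g₂)] using hP M Y hM hY
  · exact exists_ncard_dvd_dvd_le_of_ne_zero hcop h1

theorem exists_ncard_halfBox_dvd_dvd_le {n : ℕ} {g₁ g₂ : MvPolynomial (Fin (n + 1)) ℤ}
    (hcop : ∀ q : MvPolynomial (Fin (n + 1)) ℤ, q ∣ g₁ → q ∣ g₂ → q.totalDegree = 0) :
    ∃ C : ℝ, 0 ≤ C ∧ ∃ P : ℕ, ∀ M : ℕ, P ≤ M → ∀ X : ℝ, 1 ≤ X →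
      (Set.ncard {c | c ∈ halfBox n X ∧ ∃ p : ℕ, p.Prime ∧ M < p ∧
        (p : ℤ) ∣ MvPolynomial.eval c g₁ ∧ (p : ℤ) ∣ MvPolynomial.eval c g₂} : ℝ) / X ^ (n + 1) ≤
        C / M + C / X := by
  obtain ⟨C, hC, P, hP⟩ := exists_ncard_dvd_dvd_le hcop
  refine ⟨C * 2 ^ (n + 1), by positivity, P, fun M hM X hX => ?_⟩
  have hX0 : 0 < X := by linarith
  set Y := ⌈X⌉₊
  have hY1 : 1 ≤ Y := Nat.one_le_ceil_iff.2 hX0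
  have hXY : X ≤ Y := Nat.le_ceil X
  have hYX : (Y : ℝ) ≤ 2 * X := by
    have := (Nat.ceil_lt_add_one hX0.le).le
    linarith
  have hle : (Set.ncard {c | c ∈ halfBox n X ∧ ∃ p : ℕ, p.Prime ∧ M < p ∧
        (p : ℤ) ∣ MvPolynomial.eval c g₁ ∧ (p : ℤ) ∣ MvPolynomial.eval c g₂} : ℝ) ≤
      Set.ncard {c : Fin (n + 1) → ℤ | (∀ i, |c i| ≤ Y) ∧ ∃ p : ℕ, p.Prime ∧ M < p ∧
        (p : ℤ) ∣ MvPolynomial.eval c g₁ ∧ (p : ℤ) ∣ MvPolynomial.eval c g₂} := by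
    refine Nat.cast_le.2 (Set.ncard_le_ncard ?_ ?_)
    · rintro c ⟨hc, hp⟩
      refine ⟨fun i => ?_, hp⟩
      have := ((hc.2 i).trans_le hXY).le
      exact_mod_cast this
    · refine (Fintype.piFinset fun _ => symIcc Y).finite_toSet.subset ?_
      rintro c ⟨hc, -⟩
      rw [mem_coe, Fintype.mem_piFinset]
      exact fun i => mem_Icc.2 (abs_le.1 (hc i))
  rw [div_le_iff₀ (by positivity)]
  calc _ ≤ C * ((Y : ℝ) ^ (n + 1) / M + (Y : ℝ) ^ n) := hle.trans (hP M Y hM hY1)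
    _ ≤ C * ((2 * X) ^ (n + 1) / M + (2 * X) ^ n) := by gcongr
    _ ≤ C * ((2 * X) ^ (n + 1) / M + 2 * (2 * X) ^ n) := by
        gcongr
        have : 0 ≤ (2 * X) ^ n := by positivity
        linarith
    _ = _ := by
        rw [mul_pow, mul_pow]
        field_simp
        ring

theorem tendsto_prod_primes_le {f : ℕ → ℝ} (h0 : ∀ p : ℕ, p.Prime → 0 ≤ f p)
    (h1 : ∀ p : ℕ, p.Prime → f p ≤ 1) :
    Filter.Tendsto (fun M : ℕ => ∏ p ∈ (range (M + 1)).filter Nat.Prime, f p) Filter.atTop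
      (nhds (∏' q : Nat.Primes, f q)) := by
  have hanti : Antitone fun s : Finset Nat.Primes => ∏ q ∈ s, f q := by
    intro s t hst
    exact prod_le_prod_of_subset_of_le_one hst (fun q _ => h0 q q.2) fun q _ _ => h1 q q.2
  have hbdd : BddBelow (Set.range fun s : Finset Nat.Primes => ∏ q ∈ s, f q) :=
    ⟨0, by rintro _ ⟨s, rfl⟩; exact prod_nonneg fun q _ => h0 q q.2⟩
  have hprod : HasProd (fun q : Nat.Primes => f q) (⨅ s : Finset Nat.Primes, ∏ q ∈ s, f q) :=
    tendsto_atTop_ciInf hanti hbdd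
  rw [hprod.tprod_eq]
  have hs : Filter.Tendsto (fun M : ℕ => ((range (M + 1)).subtype Nat.Prime : Finset Nat.Primes))
      Filter.atTop Filter.atTop := by
    refine Filter.tendsto_atTop_finset_of_monotone (fun M M' h => ?_) fun q => ⟨q, ?_⟩
    · exact subtype_mono (range_mono (Nat.succ_le_succ h))
    · exact mem_subtype.2 (mem_range.2 (Nat.lt_succ_self _))
  refine ((tendsto_atTop_ciInf hanti hbdd).comp hs).congr fun M => ?_
  exact prod_subtype_eq_prod_filter (s := range (M + 1)) (p := Nat.Prime) f

/-- counting binary `n`-ic forms of bounded height satisfying congruence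
conditions modulo bounded prime powers, where for large primes the excluded sets lie in a
codimension-`≥ 2` subscheme (cut out by two coprime polynomials `g₁, g₂`): the count of
irreducible `Sₙ` forms in `S` with positive leading coefficient and coefficients `< X` is
`∼ 2ⁿ X^(n+1) ∏ₚ μₚ(S)` (Ekedahl sieve). -/
theorem ekedahl_sieve_count
    (n : ℕ) (hn : 3 ≤ n)
    (J : ℕ) (j : ℕ → ℕ) (hJ : ∀ p, j p ≤ J)
    (Sig : ∀ p : ℕ, Set (Fin (n + 1) → ZMod (p ^ j p)))
    (g₁ g₂ : MvPolynomial (Fin (n + 1)) ℤ)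
    (hcop : ∀ q : MvPolynomial (Fin (n + 1)) ℤ, q ∣ g₁ → q ∣ g₂ → q.totalDegree = 0)
    (hlarge : ∃ P : ℕ, ∀ p : ℕ, p.Prime → P < p →
      ∀ c : Fin (n + 1) → ℤ, (fun i => ((c i : ZMod (p ^ j p)))) ∉ Sig p →
        (p : ℤ) ∣ MvPolynomial.eval c g₁ ∧ (p : ℤ) ∣ MvPolynomial.eval c g₂) :
    Filter.Tendsto (fun X : ℝ =>
      (Nat.card {c : Fin (n + 1) → ℤ //
        (∀ p : ℕ, p.Prime → (fun i => ((c i : ZMod (p ^ j p)))) ∈ Sig p) ∧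
        Irreducible (formPoly ℚ c) ∧
        Nonempty ((formPolyX ℚ c).Gal ≃* Equiv.Perm (Fin n)) ∧
        0 < c 0 ∧ ∀ i, (|c i| : ℝ) < X} : ℝ) / X ^ (n + 1))
      Filter.atTop
      (nhds (2 ^ n * ∏' q : Nat.Primes,
        (Nat.card (Sig (q : ℕ)) : ℝ) / ((q : ℕ) : ℝ) ^ (j (q : ℕ) * (n + 1)))) := by
  obtain ⟨P, hP⟩ := hlarge
  obtain ⟨C, hC, P', htail⟩ := exists_ncard_halfBox_dvd_dvd_le hcop
  have hB := tendsto_card_halfBox_not_irreducible_gal hn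
  set μ : ℕ → ℝ := fun q => (Nat.card (Sig q) : ℝ) / (q : ℝ) ^ (j q * (n + 1)) with hμ
  have hμ1 : ∀ p : ℕ, p.Prime → μ p ≤ 1 := by
    intro p hp
    have : NeZero (p ^ j p) := ⟨(pow_pos hp.pos _).ne'⟩
    refine div_le_one_of_le₀ ?_ (by positivity)
    have h : Nat.card (Sig p) ≤ Nat.card (Fin (n + 1) → ZMod (p ^ j p)) :=
      Nat.card_le_card_of_injective _ Subtype.val_injective
    rw [Nat.card_pi, prod_const, Nat.card_zmod, card_univ, Fintype.card_fin, ← pow_mul] at h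
    exact_mod_cast h
  have hprod := (tendsto_prod_primes_le (f := μ) (fun p _ => by positivity) hμ1).const_mul
    (2 ^ n : ℝ)
  have hT : ∀ M : ℕ, Filter.Tendsto (fun X : ℝ => (Set.ncard {c | c ∈ halfBox n X ∧
      ∀ q ∈ (range (M + 1)).filter Nat.Prime, (fun i => (c i : ZMod (q ^ j q))) ∈ Sig q} : ℝ) /
        X ^ (n + 1)) Filter.atTop
      (nhds (2 ^ n * ∏ q ∈ (range (M + 1)).filter Nat.Prime, μ q)) := by
    intro M
    have h := tendsto_card_halfBox_forall_mem n ((range (M + 1)).filter Nat.Prime)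
      (fun q => q ^ j q) (fun q hq => pow_pos (mem_filter.1 hq).2.pos _)
      (fun p hp q hq hpq => Nat.Coprime.pow _ _
        ((Nat.coprime_primes (mem_filter.1 hp).2 (mem_filter.1 hq).2).2 hpq)) Sig
    simpa only [hμ, Nat.cast_pow, ← pow_mul] using h
  rw [Metric.tendsto_atTop']
  intro ε hε
  have hε8 : 0 < ε / 8 := by positivity
  obtain ⟨M, hM1, hM2, hM3⟩ := ((Metric.tendsto_nhds.1 hprod (ε / 8) hε8).and
    (((tendsto_const_div_atTop_nhds_zero_nat C).eventually (gt_mem_nhds hε8)).and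
      (Filter.eventually_ge_atTop (max P P')))).exists
  have hev := ((Metric.tendsto_nhds.1 (hT M) (ε / 8) hε8).and
    ((hB.eventually (gt_mem_nhds hε8)).and
    (((tendsto_const_nhds (x := C)).div_atTop Filter.tendsto_id).eventually
      (gt_mem_nhds hε8)))).and (Filter.eventually_ge_atTop (1 : ℝ))
  obtain ⟨X₀, hX₀⟩ := Filter.eventually_atTop.1 hev
  refine ⟨X₀, fun X hX => ?_⟩
  obtain ⟨⟨hTX, hBX, hCX⟩, hX1⟩ := hX₀ X hX.le
  have hE := htail M ((le_max_right _ _).trans hM3) X hX1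
  have hXpos : 0 < X ^ (n + 1) := by positivity
  set N : Set (Fin (n + 1) → ℤ) := {c |
        (∀ p : ℕ, p.Prime → (fun i => ((c i : ZMod (p ^ j p)))) ∈ Sig p) ∧
        Irreducible (formPoly ℚ c) ∧
        Nonempty ((formPolyX ℚ c).Gal ≃* Equiv.Perm (Fin n)) ∧
        0 < c 0 ∧ ∀ i, (|c i| : ℝ) < X} with hN
  set T := {c | c ∈ halfBox n X ∧
      ∀ q ∈ (range (M + 1)).filter Nat.Prime, (fun i => (c i : ZMod (q ^ j q))) ∈ Sig q}
  set B := {c | c ∈ halfBox n X ∧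
      ¬ (Irreducible (formPoly ℚ c) ∧ Nonempty ((formPolyX ℚ c).Gal ≃* Equiv.Perm (Fin n)))}
  set E := {c | c ∈ halfBox n X ∧ ∃ p : ℕ, p.Prime ∧ M < p ∧
        (p : ℤ) ∣ MvPolynomial.eval c g₁ ∧ (p : ℤ) ∣ MvPolynomial.eval c g₂}
  have hfin := halfBox_finite n X
  have hNT : (N.ncard : ℝ) ≤ T.ncard := by
    refine Nat.cast_le.2 (Set.ncard_le_ncard ?_ (hfin.subset fun c hc => hc.1))
    rintro c ⟨hS, -, -, hc⟩
    exact ⟨hc, fun q hq => hS q (mem_filter.1 hq).2⟩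
  have hTN : (T.ncard : ℝ) ≤ N.ncard + B.ncard + E.ncard := by
    have h : T.ncard ≤ (N ∪ B ∪ E).ncard := by
      refine Set.ncard_le_ncard ?_ (hfin.subset ?_)
      · rintro c ⟨hc, hcT⟩
        by_cases hcB : Irreducible (formPoly ℚ c) ∧
            Nonempty ((formPolyX ℚ c).Gal ≃* Equiv.Perm (Fin n))
        · by_cases hcS : ∀ p : ℕ, p.Prime → (fun i => ((c i : ZMod (p ^ j p)))) ∈ Sig p
          · exact Or.inl (Or.inl ⟨hcS, hcB.1, hcB.2, hc⟩)
          · push Not at hcS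
            obtain ⟨p, hp, hpS⟩ := hcS
            have hMp : M < p := by
              by_contra! hpM
              exact hpS (hcT p (mem_filter.2 ⟨mem_range.2 (Nat.lt_succ_of_le hpM), hp⟩))
            exact Or.inr ⟨hc, p, hp, hMp,
              hP p hp (((le_max_left _ _).trans hM3).trans_lt hMp) c hpS⟩
        · exact Or.inl (Or.inr ⟨hc, hcB⟩)
      · rintro c ((hc | hc) | hc)
        · exact hc.2.2.2
        · exact hc.1
        · exact hc.1
    exact_mod_cast h.trans ((Set.ncard_union_le _ _).trans
      (Nat.add_le_add_right (Set.ncard_union_le _ _) _))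
  have h1 : (N.ncard : ℝ) / X ^ (n + 1) ≤ T.ncard / X ^ (n + 1) :=
    div_le_div_of_nonneg_right hNT hXpos.le
  have h2 : (T.ncard : ℝ) / X ^ (n + 1) ≤
      N.ncard / X ^ (n + 1) + B.ncard / X ^ (n + 1) + E.ncard / X ^ (n + 1) := by
    rw [← add_div, ← add_div]
    exact div_le_div_of_nonneg_right hTN hXpos.le
  have hcard : Nat.card {c : Fin (n + 1) → ℤ //
        (∀ p : ℕ, p.Prime → (fun i => ((c i : ZMod (p ^ j p)))) ∈ Sig p) ∧
        Irreducible (formPoly ℚ c) ∧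
        Nonempty ((formPolyX ℚ c).Gal ≃* Equiv.Perm (Fin n)) ∧
        0 < c 0 ∧ ∀ i, (|c i| : ℝ) < X} = N.ncard := Nat.card_coe_set_eq N
  rw [hcard]
  rw [Real.dist_eq, abs_lt] at hM1 hTX ⊢
  simp only [id] at hCX
  constructor <;> linarith [hM1.1, hM1.2, hTX.1, hTX.2]
end

section
/- Let n ≥ 1, let p be a prime, and let F(x,y) ∈ ℤ[x,y] be a binary form of degree n such that F(x,y) ≡ L₁(x,y)·L₂(x,y)^{n−1} (mod p^l), where L₁ and L₂ are integral linear forms that are linearly independent modulo p, and l = 1 + v_p(n) + δ₂(p,n), with v_p(n) the p-adic valuation of n and δ₂(p,n) = 1 if p = 2 and p | n, else 0. Then there exist x, y ∈ ℤ_p with F(x,y) = 1. -/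
open Finset

open Polynomial in
/-- Hensel lifting from a reduction that is linear with leading coefficient `1`. -/
lemma exists_eval_eq_one_of_map_toZMod_eq_X {p : ℕ} [Fact p.Prime] {P : ℤ_[p][X]}
    (hP : P.map (PadicInt.toZMod (p := p)) = X) : ∃ t : ℤ_[p], P.eval t = 1 := by
  have hnorm_lt (z : ℤ_[p]) (hz : PadicInt.toZMod z = 0) : ‖z‖ < 1 := by
    rw [← PadicInt.mem_nonunits, ← IsLocalRing.mem_maximalIdeal, ← PadicInt.ker_toZMod]
    exact hz
  have heval : ‖(P - 1).aeval (1 : ℤ_[p])‖ < 1 := by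
    apply hnorm_lt
    rw [coe_aeval_eq_eval, ← eval_map_apply]
    simp [hP]
  have hderiv : ‖(P - 1).derivative.aeval (1 : ℤ_[p])‖ = 1 := by
    rw [← PadicInt.isUnit_iff]
    by_contra hunit
    have hz : PadicInt.toZMod ((P - 1).derivative.aeval (1 : ℤ_[p])) = 0 := by
      rw [← RingHom.mem_ker, PadicInt.ker_toZMod]
      exact hunit
    rw [coe_aeval_eq_eval, ← eval_map_apply, ← derivative_map] at hz
    simp [hP] at hz
  obtain ⟨z, hz, -⟩ := hensels_lemma (F := P - 1) (a := (1 : ℤ_[p])) (by rwa [hderiv, one_pow])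
  exact ⟨z, by simpa [sub_eq_zero] using hz⟩

lemma map_binEval {n : ℕ} {R S : Type*} [CommRing R] [CommRing S] (f : R →+* S)
    (c : Fin (n + 1) → R) (x y : R) :
    f (binEval c x y) = binEval (fun i => f (c i)) (f x) (f y) := by
  simp [binEval]

lemma eval₂Hom_formPoly {n : ℕ} {R S : Type*} [CommRing R] [CommRing S] (f : R →+* S)
    (c : Fin (n + 1) → ℤ) (v : Fin 2 → S) :
    MvPolynomial.eval₂Hom f v (formPoly R c) = binEval (fun i => (c i : S)) (v 0) (v 1) := by
  simp only [formPoly, formPolyR, binEval, map_sum, map_mul, map_pow, map_intCast,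
    MvPolynomial.eval₂Hom_X']

/-- if `F ≡ L₁ L₂^(n-1) (mod p^l)` with `L₁, L₂` linearly independent mod `p`
and `l = 1 + v_p(n) + δ₂(p,n)`, then `F` represents `1` over `ℤ_p`. -/
theorem local_rep_of_L1L2
    (n : ℕ) (hn : 1 ≤ n) (p : ℕ) [Fact p.Prime]
    (c : Fin (n + 1) → ℤ) (l₁ l₂ m₁ m₂ : ℤ)
    (hind : ¬ (p : ℤ) ∣ (l₁ * m₂ - l₂ * m₁))
    (hcong : formPoly
        (ZMod (p ^ (padicValNat p n + (if p = 2 ∧ 2 ∣ n then 1 else 0) + 1))) c =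
      (MvPolynomial.C
          ((l₁ : ZMod (p ^ (padicValNat p n + (if p = 2 ∧ 2 ∣ n then 1 else 0) + 1)))) *
            MvPolynomial.X 0 +
        MvPolynomial.C
          ((l₂ : ZMod (p ^ (padicValNat p n + (if p = 2 ∧ 2 ∣ n then 1 else 0) + 1)))) *
            MvPolynomial.X 1) *
      (MvPolynomial.C
          ((m₁ : ZMod (p ^ (padicValNat p n + (if p = 2 ∧ 2 ∣ n then 1 else 0) + 1)))) *
            MvPolynomial.X 0 +
        MvPolynomial.C
          ((m₂ : ZMod (p ^ (padicValNat p n + (if p = 2 ∧ 2 ∣ n then 1 else 0) + 1)))) *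
            MvPolynomial.X 1) ^ (n - 1)) :
    ∃ x y : ℤ_[p], binEval (fun i => ((c i : ℤ_[p]))) x y = 1 := by
  set k := padicValNat p n + (if p = 2 ∧ 2 ∣ n then 1 else 0) + 1
  have hunit : IsUnit ((l₁ * m₂ - l₂ * m₁ : ℤ) : ℤ_[p]) := by
    rw [PadicInt.isUnit_iff]
    refine le_antisymm (PadicInt.norm_le_one _) (not_lt.mp fun h => hind ?_)
    exact PadicInt.norm_int_lt_one_iff_dvd _ |>.mp h
  obtain ⟨d, hd⟩ := hunit.exists_left_inv
  push_cast at hd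
  let φ : ZMod (p ^ k) →+* Polynomial (ZMod p) :=
    Polynomial.C.comp (ZMod.castHom (dvd_pow_self p (Nat.succ_ne_zero _)) (ZMod p))
  let ρ := Polynomial.mapRingHom (PadicInt.toZMod (p := p))
  let x : Polynomial ℤ_[p] := Polynomial.C d * (m₂ * (Polynomial.X : Polynomial ℤ_[p]) - l₂)
  let y : Polynomial ℤ_[p] := Polynomial.C d * (l₁ - m₁ * (Polynomial.X : Polynomial ℤ_[p]))
  have hdC : Polynomial.C d * ((l₁ : Polynomial ℤ_[p]) * m₂ - l₂ * m₁) = 1 := by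
    simpa using congrArg Polynomial.C hd
  have hx : (l₁ : Polynomial ℤ_[p]) * x + l₂ * y = (Polynomial.X : Polynomial ℤ_[p]) := by
    simp only [x, y]
    linear_combination (Polynomial.X : Polynomial ℤ_[p]) * hdC
  have hy : (m₁ : Polynomial ℤ_[p]) * x + m₂ * y = 1 := by
    simp only [x, y]
    linear_combination hdC
  have hcong_eval := congrArg (MvPolynomial.eval₂Hom φ ![ρ x, ρ y]) hcong
  rw [eval₂Hom_formPoly] at hcong_eval
  have hL₁ : (l₁ : Polynomial (ZMod p)) * ρ x + l₂ * ρ y = (Polynomial.X : Polynomial (ZMod p)) := by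
    simpa [ρ] using congrArg ρ hx
  have hL₂ : (m₁ : Polynomial (ZMod p)) * ρ x + m₂ * ρ y = 1 := by
    simpa [ρ] using congrArg ρ hy
  simp only [map_mul, map_add, map_pow, MvPolynomial.coe_eval₂Hom, MvPolynomial.eval₂_X, map_intCast, Matrix.cons_val_zero, Matrix.cons_val_one, hL₁, hL₂,
    one_pow, mul_one] at hcong_eval
  have hred : ρ (binEval (fun i => (c i : Polynomial ℤ_[p])) x y) = Polynomial.X := by
    simpa [map_binEval] using hcong_eval
  obtain ⟨t, ht⟩ := exists_eval_eq_one_of_map_toZMod_eq_X hred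
  refine ⟨x.eval t, y.eval t, ?_⟩
  rw [← Polynomial.coe_evalRingHom, map_binEval] at ht
  simpa using ht
end

section
/- Let F(x,y) ∈ ℤ[x,y] be an integral binary form of degree n with naive height H(F) (the maximum of the absolute values of its coefficients), let p be a prime, and let a be an integer with |a| ≤ (p−1)/2. Then every coefficient of the binary form F(px + ay, y) has absolute value strictly less than pⁿ · (2^{n+1}/√(n+1)) · H(F); that is, H(F(px+ay,y)) < pⁿ · 2^{n+1} · (n+1)^{−1/2} · H(F). -/
open Finset

/-- An upper bound for the central binomial coefficients. -/
theorem Nat.two_mul_add_one_mul_centralBinom_sq_le (m : ℕ) :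
    (2 * m + 1) * m.centralBinom ^ 2 ≤ 16 ^ m := by
  induction m with
  | zero => simp
  | succ m ih =>
    have h := Nat.succ_mul_centralBinom_succ m
    refine le_of_mul_le_mul_left ?_ (by positivity : 0 < (m + 1) ^ 2)
    calc (m + 1) ^ 2 * ((2 * (m + 1) + 1) * (m + 1).centralBinom ^ 2)
        = (2 * m + 3) * ((m + 1) * (m + 1).centralBinom) ^ 2 := by ring
      _ = 4 * ((2 * m + 1) * (2 * m + 3)) * ((2 * m + 1) * m.centralBinom ^ 2) := by
        rw [h]; ring
      _ ≤ 4 * (4 * (m + 1) ^ 2) * 16 ^ m := by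
        gcongr ?_ * ?_
        nlinarith
      _ = (m + 1) ^ 2 * 16 ^ (m + 1) := by ring

/-- Every binomial coefficient `N.choose k` is less than `2 ^ N / √N`, in squared form. -/
theorem Nat.mul_choose_sq_lt_four_pow (N k : ℕ) : N * N.choose k ^ 2 < 4 ^ N := by
  rcases Nat.even_or_odd' N with ⟨m, rfl | rfl⟩
  · have h := Nat.two_mul_add_one_mul_centralBinom_sq_le m
    have hpos := Nat.centralBinom_pos m
    calc 2 * m * (2 * m).choose k ^ 2 ≤ 2 * m * m.centralBinom ^ 2 := by
          gcongr
          exact Nat.choose_le_centralBinom k m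
      _ < (2 * m + 1) * m.centralBinom ^ 2 := by gcongr; omega
      _ ≤ 16 ^ m := h
      _ = 4 ^ (2 * m) := by rw [pow_mul]; norm_num
  · have h := Nat.two_mul_add_one_mul_centralBinom_sq_le (m + 1)
    have hpos := Nat.centralBinom_pos (m + 1)
    have hk : (2 * m + 1).choose k ≤ (2 * m + 1).choose m := by
      have := Nat.choose_le_middle k (2 * m + 1)
      rwa [show (2 * m + 1) / 2 = m by omega] at this
    have hc : (m + 1).centralBinom = 2 * (2 * m + 1).choose m := by
      rw [Nat.centralBinom_eq_two_mul_choose, show 2 * (m + 1) = 2 * m + 1 + 1 by ring,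
        Nat.choose_succ_succ, Nat.choose_symm_half]
      ring
    have h4 : (4 : ℕ) ^ (2 * m + 1) * 4 = 16 ^ (m + 1) := by
      rw [← pow_succ, show 2 * m + 1 + 1 = 2 * (m + 1) by ring, pow_mul]; norm_num
    have h2 : (2 * m + 1) * (2 * m + 1).choose k ^ 2 ≤
        (2 * m + 1) * (2 * m + 1).choose m ^ 2 := by gcongr
    rw [hc] at h hpos
    have h3 : 0 < (2 * m + 1).choose m ^ 2 := by apply pow_pos; omega
    nlinarith

/-- The hockey-stick identity, summed over a whole initial range. -/
theorem Nat.sum_range_choose_eq_choose_succ (n m : ℕ) :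
    ∑ j ∈ range (n + 1), j.choose m = (n + 1).choose (m + 1) := by
  induction n with
  | zero => cases m <;> simp [Nat.choose_succ_succ]
  | succ n ih => rw [Finset.sum_range_succ, ih, Nat.choose_succ_succ (n + 1) m, add_comm]

/-- The coefficients of `F(bx + ay, y)` in terms of those of `F`. -/
theorem coeff_of_binEval_eq {n : ℕ} (c e : Fin (n + 1) → ℤ) (a b : ℤ)
    (he : ∀ x y : ℤ, binEval e x y = binEval c (b * x + a * y) y) (i : Fin (n + 1)) :
    e i = ∑ k : Fin (n + 1), c k *
      (a ^ (n - (k : ℕ) - (n - (i : ℕ))) * ((n - (k : ℕ)).choose (n - (i : ℕ)) : ℤ) *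
        b ^ (n - (i : ℕ))) := by
  open Polynomial in
  have hpoly : ∑ k : Fin (n + 1), C (e k) * X ^ (n - (k : ℕ)) =
      ∑ k : Fin (n + 1), C (c k) * ((X + C a) ^ (n - (k : ℕ))).comp (C b * X) := by
    refine Polynomial.funext fun x => ?_
    have := he x 1
    simpa [binEval, Polynomial.eval_finsetSum] using this
  have h := congrArg (fun q => Polynomial.coeff q (n - (i : ℕ))) hpoly
  simp only [Polynomial.finsetSum_coeff, Polynomial.coeff_C_mul,
    Polynomial.comp_C_mul_X_coeff, Polynomial.coeff_X_add_C_pow, Polynomial.coeff_X_pow] at h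
  rw [← h, Finset.sum_eq_single i]
  · simp
  · intro k _ hk
    have : n - (i : ℕ) ≠ n - (k : ℕ) := fun hik => hk (Fin.ext (by omega))
    simp [this]
  · simp

/-- height bound for the transformed form: if `|a| ≤ (p-1)/2` then every
coefficient of `F(px + ay, y)` is `< pⁿ 2^(n+1) (n+1)^(-1/2) H(F)` in absolute value. -/
theorem height_bound_of_transform
    {n : ℕ} (c : Fin (n + 1) → ℤ) (hc : c ≠ 0)
    (p : ℕ) (hp : p.Prime)
    (a : ℤ) (ha : 2 * |a| ≤ (p : ℤ) - 1)
    (e : Fin (n + 1) → ℤ)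
    (he : ∀ x y : ℤ, binEval e x y = binEval c ((p : ℤ) * x + a * y) y) :
    ∀ i, (|e i| : ℝ) <
      (p : ℝ) ^ n * 2 ^ (n + 1) / Real.sqrt (n + 1) *
        ((Finset.univ.sup fun i => (c i).natAbs : ℕ) : ℝ) := by
  intro i
  set H : ℕ := Finset.univ.sup fun i => (c i).natAbs
  have hle (k : Fin (n + 1)) : (c k).natAbs ≤ H :=
    Finset.le_sup (f := fun i => (c i).natAbs) (Finset.mem_univ k)
  have hHpos : 0 < H := by
    obtain ⟨k, hk⟩ := Function.ne_iff.mp hc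
    exact (Int.natAbs_pos.mpr hk).trans_le (hle k)
  have hap : a.natAbs ≤ p := by
    rw [Int.abs_eq_natAbs] at ha
    omega
  set m := n - (i : ℕ) with hm
  have hterm (k : Fin (n + 1)) :
      a.natAbs ^ (n - (k : ℕ) - m) * (n - (k : ℕ)).choose m * p ^ m ≤
        p ^ n * (n - (k : ℕ)).choose m := by
    rcases lt_or_ge (n - (k : ℕ)) m with h | h
    · simp [Nat.choose_eq_zero_of_lt h]
    · calc _ ≤ p ^ (n - (k : ℕ) - m) * (n - (k : ℕ)).choose m * p ^ m := by gcongr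
        _ = p ^ (n - (k : ℕ) - m + m) * (n - (k : ℕ)).choose m := by ring
        _ ≤ p ^ n * (n - (k : ℕ)).choose m := by
          gcongr
          · exact hp.one_le
          · omega
  have hnat : (e i).natAbs ≤ H * (p ^ n * (n + 1).choose (m + 1)) := by
    rw [coeff_of_binEval_eq c e a p he i, ← hm]
    calc _ ≤ ∑ k : Fin (n + 1), H * (p ^ n * (n - (k : ℕ)).choose m) := by
          refine (Int.natAbs_sum_le _ _).trans (Finset.sum_le_sum fun k _ => ?_)
          simpa [Int.natAbs_mul, Int.natAbs_pow] using Nat.mul_le_mul (hle k) (hterm k)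
      _ = H * (p ^ n * (n + 1).choose (m + 1)) := by
          rw [← Finset.mul_sum, ← Finset.mul_sum,
            Fin.sum_univ_eq_sum_range (fun k => (n - k).choose m) (n + 1),
            ← Nat.sum_range_choose_eq_choose_succ,
            ← Finset.sum_range_reflect (fun j => j.choose m)]
          simp
  have hchoose : ((n + 1).choose (m + 1) : ℝ) < 2 ^ (n + 1) / Real.sqrt (n + 1) := by
    rw [lt_div_iff₀ (by positivity)]
    refine lt_of_pow_lt_pow_left₀ 2 (by positivity) ?_
    rw [mul_pow, Real.sq_sqrt (by positivity), ← pow_mul, mul_comm (n + 1) 2, pow_mul, mul_comm]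
    exact_mod_cast Nat.mul_choose_sq_lt_four_pow (n + 1) (m + 1)
  have hp0 : (0 : ℝ) < p := by exact_mod_cast hp.pos
  have hH0 : (0 : ℝ) < H := by exact_mod_cast hHpos
  calc (|e i| : ℝ) = ((e i).natAbs : ℝ) := by simp
    _ ≤ H * (p ^ n * (n + 1).choose (m + 1)) := by exact_mod_cast hnat
    _ < H * (p ^ n * (2 ^ (n + 1) / Real.sqrt (n + 1))) := by gcongr
    _ = p ^ n * 2 ^ (n + 1) / Real.sqrt (n + 1) * H := by ring
end
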